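/- For every positive integer n, the number of representations of n by x1^2 + x2^2 + x3^2 + 2(x4^2+x5^2+x6^2) + 4(x7^2+x8^2) equals (16/11)σ_{3;χ8,1}(n) + (2/11)σ_{3;1,χ8}(n/2) + (4/11)a1(n) + (46/11)a2(n) + (136/11)a1(n/2) + (16/11)a2(n/2), with terms of non-integer argument interpreted as 0. -/

import Mathlib

open Complex Real Finset

/-- The Dedekind eta function `η(z) = q^{1/24} ∏ (1 - q^m)`, `q = e^{2πiz}`. -/
noncomputable def dedekindEta (z : ℂ) : ℂ :=
  Complex.exp (Real.pi * Complex.I * z / 12) *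
    ∏' m : ℕ, (1 - Complex.exp (2 * Real.pi * Complex.I * (m + 1) * z))

/-- `repCount a n` is the number of `(x₁,…,x₈) ∈ ℤ⁸` with `∑ aᵢ xᵢ² = n`. -/
noncomputable def repCount (a : Fin 8 → ℕ) (n : ℕ) : ℕ :=
  Nat.card {x : Fin 8 → ℤ // ∑ i, (a i : ℤ) * x i ^ 2 = (n : ℤ)}

/-- `σ_{3;1,χ₈}(n) = ∑_{d ∣ n} χ₈(d) d³`. -/
def sigmaOneChi8 (n : ℕ) : ℤ := ∑ d ∈ n.divisors, ZMod.χ₈ (d : ZMod 8) * (d : ℤ) ^ 3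

/-- `σ_{3;χ₈,1}(n) = ∑_{d ∣ n} χ₈(n/d) d³`. -/
def sigmaChi8One (n : ℕ) : ℤ := ∑ d ∈ n.divisors, ZMod.χ₈ ((n / d : ℕ) : ZMod 8) * (d : ℤ) ^ 3

/-- `f(n/2)` when `2 ∣ n`, and `0` otherwise. -/
def half (f : ℕ → ℤ) (n : ℕ) : ℚ := if 2 ∣ n then (f (n / 2) : ℚ) else 0

namespace RF7

/-- q-Pochhammer symbol `(w; Q)_∞`. -/
noncomputable def poch (w Q : ℂ) : ℂ := ∏' n : ℕ, (1 - w * Q ^ n)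

lemma summ_norm (w : ℂ) {Q : ℂ} (hQ : ‖Q‖ < 1) : Summable fun n : ℕ => ‖-(w * Q ^ n)‖ := by
  simp only [norm_neg, norm_mul, norm_pow]
  exact (summable_geometric_of_lt_one (norm_nonneg _) hQ).mul_left _

lemma mult_poch (w : ℂ) {Q : ℂ} (hQ : ‖Q‖ < 1) : Multipliable fun n : ℕ => (1 - w * Q ^ n) := by
  have := multipliable_one_add_of_summable (summ_norm w hQ)
  simpa [sub_eq_add_neg] using this

lemma poch_ne_zero {w Q : ℂ} (hQ : ‖Q‖ < 1) (h : ∀ n : ℕ, w * Q ^ n ≠ 1) : poch w Q ≠ 0 := by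
  have := tprod_one_add_ne_zero_of_summable (f := fun n : ℕ => -(w * Q ^ n))
    (fun n => by
      have := h n
      intro h0
      apply this
      linear_combination -h0) (summ_norm w hQ)
  simpa [poch, sub_eq_add_neg] using this

lemma poch_succ (w : ℂ) {Q : ℂ} (hQ : ‖Q‖ < 1) : poch w Q = (1 - w) * poch (w * Q) Q := by
  unfold poch
  rw [tprod_eq_zero_mul' (f := fun n : ℕ => (1 - w * Q ^ n))]
  · simp [pow_succ', mul_assoc]
  · simpa [pow_succ', mul_assoc] using mult_poch (w * Q) hQ

lemma poch_even_odd (w : ℂ) {Q : ℂ} (hQ : ‖Q‖ < 1) :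
    poch w Q = poch w (Q ^ 2) * poch (w * Q) (Q ^ 2) := by
  have hQ2 : ‖Q ^ 2‖ < 1 := by
    rw [norm_pow]; exact pow_lt_one₀ (norm_nonneg _) hQ two_ne_zero
  unfold poch
  rw [← tprod_even_mul_odd (f := fun n : ℕ => (1 - w * Q ^ n))]
  · congr 1 <;> refine tprod_congr fun n => ?_ <;> ring
  · simpa [pow_mul] using mult_poch w hQ2
  · have := mult_poch (w * Q) hQ2
    refine this.congr fun n => ?_
    ring

lemma poch_mul_neg (w : ℂ) {Q : ℂ} (hQ : ‖Q‖ < 1) :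
    poch w Q * poch (-w) Q = poch (w ^ 2) (Q ^ 2) := by
  unfold poch
  rw [← Multipliable.tprod_mul (mult_poch w hQ) (mult_poch (-w) hQ)]
  refine tprod_congr fun n => ?_
  ring

/-- Finite product version converges. -/
lemma tendsto_poch (w : ℂ) {Q : ℂ} (hQ : ‖Q‖ < 1) :
    Filter.Tendsto (fun N : ℕ => ∏ n ∈ range N, (1 - w * Q ^ n)) Filter.atTop
      (nhds (poch w Q)) :=
  (mult_poch w hQ).hasProd.tendsto_prod_nat

end RF7

namespace RF7

/-- finite `(Q;Q)_m` -/
noncomputable def qf (Q : ℂ) (m : ℕ) : ℂ := ∏ n ∈ range m, (1 - Q * Q ^ n)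

/-- reciprocal of `(Q;Q)_m`, zero for negative `m` -/
noncomputable def ip (Q : ℂ) (m : ℤ) : ℂ := if m < 0 then 0 else (qf Q m.toNat)⁻¹

lemma one_sub_pow_ne {Q : ℂ} (hQ : ‖Q‖ < 1) (n : ℕ) : 1 - Q * Q ^ n ≠ 0 := by
  intro h
  have h1 : Q ^ (n + 1) = 1 := by rw [pow_succ']; linear_combination -h
  have h2 : ‖Q ^ (n + 1)‖ < 1 := by
    rw [norm_pow]; exact pow_lt_one₀ (norm_nonneg _) hQ (Nat.succ_ne_zero n)
  rw [h1] at h2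
  simp at h2

lemma qf_ne {Q : ℂ} (hQ : ‖Q‖ < 1) (m : ℕ) : qf Q m ≠ 0 :=
  Finset.prod_ne_zero_iff.mpr fun n _ => one_sub_pow_ne hQ n

lemma ip_pred {Q : ℂ} (hQ : ‖Q‖ < 1) (m : ℤ) : ip Q (m - 1) = (1 - Q ^ m) * ip Q m := by
  rcases lt_trichotomy m 0 with h | h | h
  · simp [ip, h, show m - 1 < 0 by omega]
  · subst h; simp [ip]
  · obtain ⟨k, rfl⟩ : ∃ k : ℕ, m = k + 1 := ⟨(m - 1).toNat, by omega⟩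
    have h1 : ¬ ((k : ℤ) + 1 < 0) := by omega
    have h2 : ((k : ℤ) + 1).toNat = k + 1 := by omega
    simp only [ip, add_sub_cancel_right, h1, h2, if_false]
    have h3 : ¬ ((k : ℤ) < 0) := by omega
    simp only [h3, if_false, Int.toNat_natCast]
    have : qf Q (k + 1) = qf Q k * (1 - Q ^ ((k : ℤ) + 1)) := by
      unfold qf
      rw [Finset.prod_range_succ]
      congr 2
      exact_mod_cast (pow_succ' Q k).symm
    have h4 := qf_ne hQ (k + 1)
    have h5 := qf_ne hQ k
    rw [this] at h4 ⊢
    have h6 : (1 - Q ^ ((k : ℤ) + 1)) ≠ 0 := right_ne_zero_of_mul h4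
    field_simp

lemma hs_congr {f g : ℤ → ℂ} {a b : ℂ} (h : HasSum f a) (hf : ∀ k, g k = f k) (ha : b = a) :
    HasSum g b := by
  have : g = f := funext hf
  rw [this, ha]; exact h

lemma finite_jtp {p t : ℂ} (hp0 : p ≠ 0) (hp : ‖p‖ < 1) (ht : t ≠ 0) (N : ℕ) :
    HasSum (fun k : ℤ => qf (p ^ 2) (2 * N) * ip (p ^ 2) (N - k) * ip (p ^ 2) (N + k)
      * (t ^ k * p ^ (k ^ 2)))
      (∏ n ∈ range N, ((1 + t * p * (p ^ 2) ^ n) * (1 + p / t * (p ^ 2) ^ n))) := by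
  have hQ : ‖p ^ 2‖ < 1 := by
    rw [norm_pow]; exact pow_lt_one₀ (norm_nonneg _) hp two_ne_zero
  induction N with
  | zero =>
    have := hasSum_single (f := fun k : ℤ => qf (p ^ 2) (2 * 0) * ip (p ^ 2) (((0 : ℕ) : ℤ) - k)
      * ip (p ^ 2) (((0 : ℕ) : ℤ) + k) * (t ^ k * p ^ (k ^ 2))) 0 (by
        intro k hk
        rcases lt_or_gt_of_ne hk with h | h
        · simp [ip, h]
        · simp [ip, h])
    simpa [ip, qf] using this
  | succ N ih =>
    rw [Finset.prod_range_succ]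
    have s1 := (Equiv.hasSum_iff (Equiv.subRight (1 : ℤ))).mpr ih
    have s2 := (Equiv.hasSum_iff (Equiv.addRight (1 : ℤ))).mpr ih
    have := ((ih.mul_left (1 + p ^ (4 * N + 2))).add (s1.mul_left (t * p ^ (2 * N + 1)))).add
      (s2.mul_left (t⁻¹ * p ^ (2 * N + 1)))
    refine hs_congr this (fun k => ?_) ?_
    · simp only [Function.comp, Equiv.subRight_apply, Equiv.coe_addRight]
      have e1 : qf (p ^ 2) (2 * (N + 1)) = qf (p ^ 2) (2 * N) * (1 - p ^ (4 * N + 2)) *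
          (1 - p ^ (4 * N + 4)) := by
        rw [show 2 * (N + 1) = 2 * N + 1 + 1 by ring]
        unfold qf
        rw [Finset.prod_range_succ, Finset.prod_range_succ]
        ring
      set u := ip (p ^ 2) ((N : ℤ) + 1 - k) with hu
      set v := ip (p ^ 2) ((N : ℤ) + 1 + k) with hv
      set A : ℂ := (p ^ 2) ^ ((N : ℤ) + 1 - k) with hA
      set B : ℂ := (p ^ 2) ^ ((N : ℤ) + 1 + k) with hB
      have hp2 : p ^ 2 ≠ 0 := pow_ne_zero _ hp0
      have a1 : ip (p ^ 2) (N - k) = (1 - A) * u := by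
        rw [hu, hA, ← ip_pred hQ]; congr 1; ring
      have a2 : ip (p ^ 2) (N + k) = (1 - B) * v := by
        rw [hv, hB, ← ip_pred hQ]; congr 1; ring
      have a3 : ip (p ^ 2) (N - (k + 1)) = (1 - A / p ^ 2) * ((1 - A) * u) := by
        rw [← a1, hA, div_eq_mul_inv, ← zpow_sub_one₀ hp2, show (N : ℤ) + 1 - k - 1 = N - k by ring,
          ← ip_pred hQ]; congr 1; ring
      have a4 : ip (p ^ 2) (N + (k - 1)) = (1 - B / p ^ 2) * ((1 - B) * v) := by
        rw [← a2, hB, div_eq_mul_inv, ← zpow_sub_one₀ hp2, show (N : ℤ) + 1 + k - 1 = N + k by ring,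
          ← ip_pred hQ]; congr 1; ring
      have a5 : ip (p ^ 2) (N - (k - 1)) = u := by rw [hu]; congr 1; ring
      have a6 : ip (p ^ 2) (N + (k + 1)) = v := by rw [hv]; congr 1; ring
      have a7 : ip (p ^ 2) (((N + 1 : ℕ) : ℤ) - k) = u := by rw [hu]; push_cast; rfl
      have a8 : ip (p ^ 2) (((N + 1 : ℕ) : ℤ) + k) = v := by rw [hv]; push_cast; rfl
      have c1 : A * B = p ^ (4 * N + 4) := by
        rw [hA, hB, ← zpow_add₀ hp2, ← zpow_natCast p 2, ← zpow_mul, ← zpow_natCast p]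
        congr 1; push_cast; ring
      have c2 : p ^ (4 * N + 4) = p ^ (4 * N + 2) * p ^ 2 := by ring
      have d1 : t * p ^ (2 * N + 1) * (t ^ (k - 1) * p ^ ((k - 1) ^ 2)) =
          A * (t ^ k * p ^ (k ^ 2)) := by
        rw [zpow_sub_one₀ ht, hA, ← zpow_natCast p 2, ← zpow_mul, ← zpow_natCast p (2 * N + 1)]
        have : p ^ (((2 * N + 1 : ℕ) : ℤ)) * p ^ ((k - 1) ^ 2) =
          p ^ (((2 : ℕ) : ℤ) * ((N : ℤ) + 1 - k)) * p ^ (k ^ 2) := by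
          rw [← zpow_add₀ hp0, ← zpow_add₀ hp0]; congr 1; push_cast; ring
        field_simp
        linear_combination this
      have d2 : t⁻¹ * p ^ (2 * N + 1) * (t ^ (k + 1) * p ^ ((k + 1) ^ 2)) =
          B * (t ^ k * p ^ (k ^ 2)) := by
        rw [zpow_add_one₀ ht, hB, ← zpow_natCast p 2, ← zpow_mul, ← zpow_natCast p (2 * N + 1)]
        have : p ^ (((2 * N + 1 : ℕ) : ℤ)) * p ^ ((k + 1) ^ 2) =
          p ^ (((2 : ℕ) : ℤ) * ((N : ℤ) + 1 + k)) * p ^ (k ^ 2) := by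
          rw [← zpow_add₀ hp0, ← zpow_add₀ hp0]; congr 1; push_cast; ring
        field_simp
        linear_combination this
      rw [e1, a7, a8, a1, a2, a3, a4, a5, a6]
      have key : (1 - p ^ (4 * N + 2)) * (1 - p ^ (4 * N + 4)) =
          (1 + p ^ (4 * N + 2)) * ((1 - A) * (1 - B)) + (1 - B / p ^ 2) * (1 - B) * A
          + (1 - A / p ^ 2) * (1 - A) * B := by
        have : p ^ (4 * N + 2) = A * B / p ^ 2 := by rw [c1, c2]; field_simp
        rw [← c1, this]
        field_simp
        ring
      linear_combination (qf (p ^ 2) (2 * N) * u * v * (t ^ k * p ^ (k ^ 2))) * key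
        - (qf (p ^ 2) (2 * N) * u * ((1 - B / p ^ 2) * ((1 - B) * v))) * d1
        - (qf (p ^ 2) (2 * N) * ((1 - A / p ^ 2) * ((1 - A) * u)) * v) * d2
    · have : (p ^ 2) ^ N = p ^ (2 * N) := by rw [← pow_mul]
      rw [this]
      field_simp
      ring

lemma exists_exp {p : ℂ} (hp0 : p ≠ 0) (hp : ‖p‖ < 1) :
    ∃ τ : ℂ, 0 < τ.im ∧ cexp (π * I * τ) = p := by
  refine ⟨Complex.log p / (π * I), ?_, ?_⟩
  · have h1 : Complex.log p / (π * I) = (-(Complex.log p) / π) * I := by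
      have : (π : ℂ) ≠ 0 := by exact_mod_cast Real.pi_ne_zero
      field_simp
      rw [I_sq]
      ring
    have h3 : -(Complex.log p) / π = ((-1 / π : ℝ) : ℂ) * Complex.log p := by
      push_cast; ring
    rw [h1, h3, Complex.mul_I_im, Complex.re_ofReal_mul, Complex.log_re]
    have : Real.log ‖p‖ < 0 := Real.log_neg (norm_pos_iff.mpr hp0) hp
    have hpi := Real.pi_pos
    have : -1 / π < 0 := by apply div_neg_of_neg_of_pos <;> linarith
    exact mul_pos_of_neg_of_neg this ‹_›
  · have : (π : ℂ) ≠ 0 := by exact_mod_cast Real.pi_ne_zero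
    rw [mul_div_cancel₀ _ (mul_ne_zero this I_ne_zero), Complex.exp_log hp0]

lemma exists_exp2 {t : ℂ} (ht : t ≠ 0) : ∃ z : ℂ, cexp (2 * π * I * z) = t := by
  refine ⟨Complex.log t / (2 * π * I), ?_⟩
  have : (π : ℂ) ≠ 0 := by exact_mod_cast Real.pi_ne_zero
  rw [mul_div_cancel₀ _ (by simp [I_ne_zero, this]), Complex.exp_log ht]

lemma theta_term (z τ : ℂ) (k : ℤ) :
    jacobiTheta₂_term k z τ = cexp (2 * π * I * z) ^ k * cexp (π * I * τ) ^ (k ^ 2) := by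
  rw [jacobiTheta₂_term, ← Complex.exp_int_mul, ← Complex.exp_int_mul, ← Complex.exp_add]
  congr 1; push_cast; ring

lemma theta_summable {p t : ℂ} (hp0 : p ≠ 0) (hp : ‖p‖ < 1) (ht : t ≠ 0) :
    Summable fun k : ℤ => t ^ k * p ^ (k ^ 2) := by
  obtain ⟨τ, hτ, rfl⟩ := exists_exp hp0 hp
  obtain ⟨z, rfl⟩ := exists_exp2 ht
  have := (summable_jacobiTheta₂_term_iff z τ).mpr hτ
  simpa only [theta_term] using this

lemma qf_tendsto {Q : ℂ} (hQ : ‖Q‖ < 1) :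
    Filter.Tendsto (qf Q) Filter.atTop (nhds (poch Q Q)) := tendsto_poch Q hQ

lemma pochQQ_ne {Q : ℂ} (hQ : ‖Q‖ < 1) : poch Q Q ≠ 0 :=
  poch_ne_zero hQ fun n h => one_sub_pow_ne hQ n (by rw [h]; ring)

lemma ip_tendsto {Q : ℂ} (hQ : ‖Q‖ < 1) :
    Filter.Tendsto (ip Q) Filter.atTop (nhds (poch Q Q)⁻¹) := by
  have h1 : Filter.Tendsto (fun m : ℤ => (qf Q m.toNat)⁻¹) Filter.atTop (nhds (poch Q Q)⁻¹) := by
    refine Filter.Tendsto.inv₀ ?_ (pochQQ_ne hQ)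
    refine (qf_tendsto hQ).comp ?_
    refine Filter.tendsto_atTop.mpr fun b => ?_
    filter_upwards [Filter.eventually_ge_atTop (b : ℤ)] with m hm
    omega
  refine h1.congr' ?_
  filter_upwards [Filter.eventually_ge_atTop (0 : ℤ)] with m hm
  simp [ip, not_lt.mpr hm]

lemma ip_bound {Q : ℂ} (hQ : ‖Q‖ < 1) : ∃ C : ℝ, ∀ m : ℤ, ‖ip Q m‖ ≤ C := by
  have h1 : Filter.Tendsto (fun m : ℕ => (qf Q m)⁻¹) Filter.atTop (nhds (poch Q Q)⁻¹) :=
    (qf_tendsto hQ).inv₀ (pochQQ_ne hQ)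
  obtain ⟨C, hC⟩ := (Metric.isBounded_range_of_tendsto _ h1).exists_norm_le
  have hC0 : 0 ≤ C := (norm_nonneg _).trans (hC _ ⟨0, rfl⟩)
  refine ⟨C, fun m => ?_⟩
  unfold ip
  split_ifs
  · simpa using hC0
  · exact hC _ ⟨m.toNat, rfl⟩

/-- Jacobi triple product. -/
theorem jtp {p t : ℂ} (hp0 : p ≠ 0) (hp : ‖p‖ < 1) (ht : t ≠ 0) :
    HasSum (fun k : ℤ => t ^ k * p ^ (k ^ 2))
      (poch (p ^ 2) (p ^ 2) * poch (-(t * p)) (p ^ 2) * poch (-(p / t)) (p ^ 2)) := by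
  have hQ : ‖p ^ 2‖ < 1 := by
    rw [norm_pow]; exact pow_lt_one₀ (norm_nonneg _) hp two_ne_zero
  have hs := theta_summable hp0 hp ht
  obtain ⟨C, hC⟩ := ip_bound hQ
  obtain ⟨C', hC'⟩ := (Metric.isBounded_range_of_tendsto _ (qf_tendsto hQ)).exists_norm_le
  have hC0 : 0 ≤ C := (norm_nonneg _).trans (hC 0)
  have hC0' : 0 ≤ C' := (norm_nonneg _).trans (hC' _ ⟨0, rfl⟩)
  have key := tendsto_tsum_of_dominated_convergence (𝓕 := Filter.atTop)
    (f := fun (N : ℕ) (k : ℤ) => qf (p ^ 2) (2 * N) * ip (p ^ 2) (N - k) * ip (p ^ 2) (N + k)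
      * (t ^ k * p ^ (k ^ 2)))
    (g := fun k : ℤ => poch (p ^ 2) (p ^ 2) * (poch (p ^ 2) (p ^ 2))⁻¹ *
      (poch (p ^ 2) (p ^ 2))⁻¹ * (t ^ k * p ^ (k ^ 2)))
    (bound := fun k : ℤ => C' * C * C * ‖t ^ k * p ^ (k ^ 2)‖)
    (hs.norm.mul_left _) (by
      intro k
      refine Filter.Tendsto.mul_const _ ?_
      refine Filter.Tendsto.mul (Filter.Tendsto.mul ?_ ?_) ?_
      · exact (qf_tendsto hQ).comp (Filter.tendsto_id.const_mul_atTop' (by norm_num))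
      · refine (ip_tendsto hQ).comp ?_
        exact Filter.tendsto_atTop_add_const_right _ (-k) tendsto_natCast_atTop_atTop
      · refine (ip_tendsto hQ).comp ?_
        exact Filter.tendsto_atTop_add_const_right _ k tendsto_natCast_atTop_atTop)
    (Filter.Eventually.of_forall fun N k => by
      rw [norm_mul, norm_mul, norm_mul]
      gcongr
      · exact hC' _ ⟨_, rfl⟩
      · exact hC _
      · exact hC _)
  have h2 : Filter.Tendsto (fun N : ℕ => ∏ n ∈ range N,
      ((1 + t * p * (p ^ 2) ^ n) * (1 + p / t * (p ^ 2) ^ n))) Filter.atTop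
      (nhds (poch (-(t * p)) (p ^ 2) * poch (-(p / t)) (p ^ 2))) := by
    have := (tendsto_poch (-(t * p)) hQ).mul (tendsto_poch (-(p / t)) hQ)
    refine this.congr fun N => ?_
    rw [← Finset.prod_mul_distrib]
    refine Finset.prod_congr rfl fun n _ => ?_
    ring
  have h3 : (fun N : ℕ => ∏ n ∈ range N,
      ((1 + t * p * (p ^ 2) ^ n) * (1 + p / t * (p ^ 2) ^ n))) = fun N : ℕ =>
      ∑' k : ℤ, qf (p ^ 2) (2 * N) * ip (p ^ 2) (N - k) * ip (p ^ 2) (N + k)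
      * (t ^ k * p ^ (k ^ 2)) := by
    funext N
    exact (finite_jtp hp0 hp ht N).tsum_eq.symm
  rw [h3] at h2
  have h4 := tendsto_nhds_unique key h2
  rw [tsum_mul_left] at h4
  have hE := pochQQ_ne hQ
  have h5 : ∑' k : ℤ, t ^ k * p ^ (k ^ 2) =
      poch (p ^ 2) (p ^ 2) * poch (-(t * p)) (p ^ 2) * poch (-(p / t)) (p ^ 2) := by
    rw [mul_assoc, ← h4]
    field_simp
  rw [← h5]
  exact hs.hasSum

end RF7

namespace RF7

/-- two-variable theta series -/
noncomputable def Th (t p : ℂ) : ℂ := ∑' k : ℤ, t ^ k * p ^ (k ^ 2)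

lemma Th_hasSum {p t : ℂ} (hp0 : p ≠ 0) (hp : ‖p‖ < 1) (ht : t ≠ 0) :
    HasSum (fun k : ℤ => t ^ k * p ^ (k ^ 2)) (Th t p) := (theta_summable hp0 hp ht).hasSum

lemma Th_eq {p t : ℂ} (hp0 : p ≠ 0) (hp : ‖p‖ < 1) (ht : t ≠ 0) :
    Th t p = poch (p ^ 2) (p ^ 2) * poch (-(t * p)) (p ^ 2) * poch (-(p / t)) (p ^ 2) :=
  (jtp hp0 hp ht).tsum_eq

lemma Th_shift {p t : ℂ} (hp0 : p ≠ 0) (ht : t ≠ 0) :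
    Th (t * p ^ 2) p = t⁻¹ * p⁻¹ * Th t p := by
  unfold Th
  rw [← tsum_mul_left, ← (Equiv.addRight (1 : ℤ)).tsum_eq
    (fun k : ℤ => t⁻¹ * p⁻¹ * (t ^ k * p ^ (k ^ 2)))]
  refine tsum_congr fun k => ?_
  simp only [Equiv.coe_addRight]
  rw [mul_zpow, zpow_add_one₀ ht, ← zpow_natCast p 2, ← zpow_mul, mul_assoc, ← zpow_add₀ hp0]
  have : p ^ (((2 : ℕ) : ℤ) * k + k ^ 2) = p⁻¹ * p ^ ((k + 1) ^ 2) := by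
    rw [← zpow_neg_one, ← zpow_add₀ hp0]; congr 1; push_cast; ring
  rw [this]
  field_simp

lemma norm_sq_lt {p : ℂ} (hp : ‖p‖ < 1) : ‖p ^ 2‖ < 1 := by
  rw [norm_pow]; exact pow_lt_one₀ (norm_nonneg _) hp two_ne_zero

lemma norm_pow_lt {p : ℂ} (hp : ‖p‖ < 1) {n : ℕ} (hn : n ≠ 0) : ‖p ^ n‖ < 1 := by
  rw [norm_pow]; exact pow_lt_one₀ (norm_nonneg _) hp hn

noncomputable def ee (a p : ℂ) : ℂ := Th (a ^ 2) (p ^ 2)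
noncomputable def oo (a p : ℂ) : ℂ := a * Th ((a * p) ^ 2) (p ^ 2)

lemma hasSum_parity {f : ℤ × ℤ → ℂ} {A B : ℂ}
    (h0 : HasSum (fun x : ℤ × ℤ => f (x.1 + x.2, x.1 - x.2)) A)
    (h1 : HasSum (fun x : ℤ × ℤ => f (x.1 + x.2 + 1, x.1 - x.2)) B) : HasSum f (A + B) := by
  have i0 : Function.Injective (fun x : ℤ × ℤ => (x.1 + x.2, x.1 - x.2)) := by
    rintro ⟨x, y⟩ ⟨x', y'⟩ h
    simp only [Prod.mk.injEq] at h ⊢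
    omega
  have i1 : Function.Injective (fun x : ℤ × ℤ => (x.1 + x.2 + 1, x.1 - x.2)) := by
    rintro ⟨x, y⟩ ⟨x', y'⟩ h
    simp only [Prod.mk.injEq] at h ⊢
    omega
  have hc : IsCompl (Set.range (fun x : ℤ × ℤ => (x.1 + x.2, x.1 - x.2)))
      (Set.range (fun x : ℤ × ℤ => (x.1 + x.2 + 1, x.1 - x.2))) := by
    constructor
    · rw [Set.disjoint_iff]
      rintro x ⟨⟨⟨u, v⟩, rfl⟩, ⟨⟨u', v'⟩, h⟩⟩
      simp only [Prod.mk.injEq] at h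
      omega
    · rw [codisjoint_iff_le_sup]
      rintro ⟨x, y⟩ -
      rcases Int.even_or_odd (x + y) with ⟨m, hm⟩ | ⟨m, hm⟩
      · left; exact ⟨(m, x - m), by simp only [Prod.mk.injEq]; omega⟩
      · right; exact ⟨(m, x - m - 1), by simp only [Prod.mk.injEq]; omega⟩
  exact HasSum.add_isCompl hc (i0.hasSum_range_iff.mpr h0) (i1.hasSum_range_iff.mpr h1)

lemma add_term0 {p a b : ℂ} (hp0 : p ≠ 0) (ha : a ≠ 0) (hb : b ≠ 0) (i j : ℤ) :
    ((a * b) ^ (i + j) * p ^ ((i + j) ^ 2)) * ((a / b) ^ (i - j) * p ^ ((i - j) ^ 2)) =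
    ((a ^ 2) ^ i * (p ^ 2) ^ (i ^ 2)) * ((b ^ 2) ^ j * (p ^ 2) ^ (j ^ 2)) := by
  have E : ∀ x : ℂ, ∀ k : ℤ, (x ^ 2) ^ k = x ^ (2 * k) := fun x k => by
    rw [← zpow_natCast x 2, ← zpow_mul]; norm_num
  have h1 : (a * b) ^ (i + j) * (a / b) ^ (i - j) = a ^ (2 * i) * b ^ (2 * j) := by
    have ha1 : a ^ (2 * i) = a ^ (i + j) * a ^ (i - j) := by
      rw [← zpow_add₀ ha]; congr 1; ring
    have hb1 : b ^ (i + j) = b ^ (2 * j) * b ^ (i - j) := by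
      rw [← zpow_add₀ hb]; congr 1; ring
    have hb2 : b ^ (i - j) ≠ 0 := zpow_ne_zero _ hb
    rw [mul_zpow, div_zpow, ha1, hb1]
    field_simp
  have h2 : p ^ ((i + j) ^ 2) * p ^ ((i - j) ^ 2) = p ^ (2 * i ^ 2) * p ^ (2 * j ^ 2) := by
    rw [← zpow_add₀ hp0, ← zpow_add₀ hp0]; congr 1; ring
  rw [E, E, E, E]
  linear_combination (p ^ ((i + j) ^ 2) * p ^ ((i - j) ^ 2)) * h1
    + (a ^ (2 * i) * b ^ (2 * j)) * h2

lemma add_term1 {p a b : ℂ} (hp0 : p ≠ 0) (ha : a ≠ 0) (hb : b ≠ 0) (i j : ℤ) :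
    ((a * b) ^ (i + j + 1) * p ^ ((i + j + 1) ^ 2)) * ((a / b) ^ (i - j) * p ^ ((i - j) ^ 2)) =
    p * (a * b) * ((((a * p) ^ 2) ^ i * (p ^ 2) ^ (i ^ 2)) *
      (((b * p) ^ 2) ^ j * (p ^ 2) ^ (j ^ 2))) := by
  have E : ∀ x : ℂ, ∀ k : ℤ, (x ^ 2) ^ k = x ^ (2 * k) := fun x k => by
    rw [← zpow_natCast x 2, ← zpow_mul]; norm_num
  have h1 : (a * b) ^ (i + j + 1) * (a / b) ^ (i - j) =
      a * b * (a ^ (2 * i) * b ^ (2 * j)) := by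
    have ha1 : a ^ (2 * i) = a ^ (i + j) * a ^ (i - j) := by
      rw [← zpow_add₀ ha]; congr 1; ring
    have hb1 : b ^ (i + j) = b ^ (2 * j) * b ^ (i - j) := by
      rw [← zpow_add₀ hb]; congr 1; ring
    have hb2 : b ^ (i - j) ≠ 0 := zpow_ne_zero _ hb
    rw [zpow_add_one₀ (mul_ne_zero ha hb), mul_zpow, div_zpow, ha1, hb1]
    field_simp
  have h2 : p ^ ((i + j + 1) ^ 2) * p ^ ((i - j) ^ 2) =
      p * (p ^ (2 * i) * p ^ (2 * i ^ 2) * (p ^ (2 * j) * p ^ (2 * j ^ 2))) := by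
    rw [← zpow_add₀ hp0, ← zpow_add₀ hp0, ← zpow_add₀ hp0, ← zpow_add₀ hp0, ← zpow_one_add₀ hp0]
    congr 1; ring
  rw [E, E, E, E, mul_zpow a p, mul_zpow b p]
  linear_combination (p ^ ((i + j + 1) ^ 2) * p ^ ((i - j) ^ 2)) * h1
    + (a * b * (a ^ (2 * i) * b ^ (2 * j))) * h2

lemma mul_hasSum {f g : ℤ → ℂ} {A B : ℂ} (hf : HasSum f A) (hg : HasSum g B) :
    HasSum (fun x : ℤ × ℤ => f x.1 * g x.2) (A * B) :=
  hf.mul hg (summable_mul_of_summable_norm hf.summable.norm hg.summable.norm)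

lemma addition {p a b : ℂ} (hp0 : p ≠ 0) (hp : ‖p‖ < 1) (ha : a ≠ 0) (hb : b ≠ 0) :
    Th (a * b) p * Th (a / b) p = ee a p * ee b p + p * (oo a p * oo b p) := by
  have hp2 : p ^ 2 ≠ 0 := pow_ne_zero _ hp0
  have hpl := norm_sq_lt hp
  have s1 := Th_hasSum hp0 hp (mul_ne_zero ha hb)
  have s2 := Th_hasSum hp0 hp (div_ne_zero ha hb)
  have s3 := mul_hasSum s1 s2
  have e3 := mul_hasSum (Th_hasSum hp2 hpl (pow_ne_zero 2 ha)) (Th_hasSum hp2 hpl (pow_ne_zero 2 hb))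
  have o3 := (mul_hasSum (Th_hasSum hp2 hpl (pow_ne_zero 2 (mul_ne_zero ha hp0)))
    (Th_hasSum hp2 hpl (pow_ne_zero 2 (mul_ne_zero hb hp0)))).mul_left (p * (a * b))
  simp only [← add_term0 hp0 ha hb] at e3
  simp only [← add_term1 hp0 ha hb] at o3
  have := hasSum_parity (f := fun x : ℤ × ℤ => ((a * b) ^ x.1 * p ^ (x.1 ^ 2)) *
      ((a / b) ^ x.2 * p ^ (x.2 ^ 2))) e3 o3
  rw [s3.unique this]
  unfold ee oo
  ring

lemma ee_shift {p w : ℂ} (hw : w ≠ 0) : ee (-(p * w)) p = w⁻¹ * oo w p := by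
  unfold ee oo
  rw [neg_sq, mul_comm p w]; field_simp

lemma oo_shift {p w : ℂ} (hp0 : p ≠ 0) (hw : w ≠ 0) :
    oo (-(p * w)) p = -(w⁻¹ * p⁻¹ * ee w p) := by
  unfold ee oo
  rw [show (-(p * w) * p) ^ 2 = w ^ 2 * (p ^ 2) ^ 2 by ring,
    Th_shift (pow_ne_zero _ hp0) (pow_ne_zero _ hw)]
  field_simp

lemma cross {p a w : ℂ} (hp0 : p ≠ 0) (hp : ‖p‖ < 1) (ha : a ≠ 0) (hw : w ≠ 0) :
    ee a p * oo w p - oo a p * ee w p = w * (Th (-(p * (a * w))) p * Th (-(a / (p * w))) p) := by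
  have := addition hp0 hp ha (neg_ne_zero.mpr (mul_ne_zero hp0 hw))
  rw [ee_shift hw, oo_shift hp0 hw] at this
  rw [show -(p * (a * w)) = a * -(p * w) by ring, show -(a / (p * w)) = a / -(p * w) by
    rw [div_neg], this]
  field_simp
  ring

end RF7

namespace RF7

noncomputable def ss (z : ℂ) : ℂ := z / (1 - z) ^ 2

lemma ss_inv (z : ℂ) : ss z⁻¹ = ss z := by
  unfold ss
  by_cases h0 : z = 0
  · simp [h0]
  by_cases h1 : z = 1
  · simp [h1]
  have : 1 - z ≠ 0 := fun h => h1 (by linear_combination -h)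
  have h2 : z - 1 ≠ 0 := fun h => h1 (by linear_combination h)
  have h3 : 1 - z⁻¹ ≠ 0 := by
    rw [show 1 - z⁻¹ = (z - 1) / z by field_simp]
    exact div_ne_zero h2 h0
  field_simp
  ring

/-- generic summability along a geometric progression -/
lemma summable_geom_comp {h : ℂ → ℂ} {C : ℝ} (hh : ∀ x : ℂ, ‖x‖ ≤ 1 / 2 → ‖h x‖ ≤ C * ‖x‖)
    (w : ℂ) {Q : ℂ} (hQ : ‖Q‖ < 1) : Summable fun n : ℕ => h (w * Q ^ n) := by
  have hg : Summable fun n : ℕ => C * (‖w‖ * ‖Q‖ ^ n) :=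
    ((summable_geometric_of_lt_one (norm_nonneg _) hQ).mul_left _).mul_left _
  have ht : Filter.Tendsto (fun n : ℕ => ‖w‖ * ‖Q‖ ^ n) Filter.atTop (nhds 0) := by
    simpa using (tendsto_pow_atTop_nhds_zero_of_lt_one (norm_nonneg _) hQ).const_mul ‖w‖
  refine Summable.of_norm_bounded_eventually_nat hg ?_
  filter_upwards [ht.eventually (ge_mem_nhds (by norm_num : (0 : ℝ) < 1 / 2))] with n hn
  have := hh (w * Q ^ n) (by simpa using hn)
  simpa using this

lemma norm_one_sub_ge {x : ℂ} (hx : ‖x‖ ≤ 1 / 2) : 1 / 2 ≤ ‖1 - x‖ := by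
  have := norm_sub_norm_le (1 : ℂ) x
  rw [norm_one] at this
  linarith

lemma ss_bound (x : ℂ) (hx : ‖x‖ ≤ 1 / 2) : ‖ss x‖ ≤ 4 * ‖x‖ := by
  unfold ss
  have h := norm_one_sub_ge hx
  rw [norm_div, norm_pow, div_le_iff₀ (by positivity)]
  have : 1 / 4 ≤ ‖1 - x‖ ^ 2 := by nlinarith
  nlinarith [norm_nonneg x]

lemma ss_summable (w : ℂ) {Q : ℂ} (hQ : ‖Q‖ < 1) : Summable fun n : ℕ => ss (w * Q ^ n) :=
  summable_geom_comp ss_bound w hQ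

lemma zpow_add_one₀' {Q : ℂ} (n : ℕ) : Q ^ ((n : ℤ) + 1) = Q ^ (n : ℤ) * Q := by
  exact_mod_cast pow_succ Q n

lemma bilateral_hasSum {h : ℂ → ℂ} (hinv : ∀ x, h x⁻¹ = h x) {Q z : ℂ} 
    (hs : ∀ w, Summable fun n : ℕ => h (w * Q ^ n)) :
    HasSum (fun n : ℤ => h (z * Q ^ n))
      (∑' n : ℕ, h (z * Q ^ n) + ∑' n : ℕ, h (Q / z * Q ^ n)) := by
  refine HasSum.of_nat_of_neg_add_one ?_ ?_
  · simpa using (hs z).hasSum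
  · have := (hs (Q / z)).hasSum
    have e : (fun n : ℕ => h (z * Q ^ (-((n : ℤ) + 1)))) = fun n : ℕ => h (Q / z * Q ^ n) := by
      funext n
      rw [← hinv]
      congr 1
      rw [mul_inv, ← zpow_neg, neg_neg, zpow_add_one₀' n, zpow_natCast]
      ring
    rw [e]
    exact this

noncomputable def JJ (Q z : ℂ) : ℂ := ∑' n : ℤ, ss (z * Q ^ n)

/-- the product `∏ (1 + l u_n)` -/
noncomputable def PP (u : ℕ → ℂ) (l : ℂ) : ℂ := ∏' n : ℕ, (1 + l * u n)

lemma PP_lim {u : ℕ → ℂ} (hu : Summable u) {l : ℕ → ℂ} (hl : Filter.Tendsto l Filter.atTop (nhds 0))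
    (hl0 : ∀ m, l m ≠ 0) :
    Filter.Tendsto (fun m => (PP u (l m) - 1) / l m) Filter.atTop (nhds (∑' n, u n)) := by
  have hun := hu.norm
  have hP : ∀ (c : ℂ), ‖c‖ ≤ 1 → ∀ n : ℕ, ‖∏ i ∈ range n, (1 + c * u i)‖ ≤
      Real.exp (∑' i, ‖u i‖) := by
    intro c hc n
    rw [norm_prod]
    calc ∏ i ∈ range n, ‖1 + c * u i‖ ≤ ∏ i ∈ range n, Real.exp ‖u i‖ := by
          refine Finset.prod_le_prod (fun _ _ => norm_nonneg _) fun i _ => ?_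
          calc ‖1 + c * u i‖ ≤ ‖(1 : ℂ)‖ + ‖c * u i‖ := norm_add_le _ _
            _ ≤ ‖u i‖ + 1 := by
              rw [norm_one, norm_mul]; nlinarith [norm_nonneg (u i)]
            _ ≤ _ := Real.add_one_le_exp _
      _ = Real.exp (∑ i ∈ range n, ‖u i‖) := (Real.exp_sum _ _).symm
      _ ≤ _ := Real.exp_le_exp.mpr (hun.sum_le_tsum _ (fun _ _ => norm_nonneg _))
  have hm : ∀ c : ℂ, Multipliable fun n => 1 + c * u n := fun c => by
    refine multipliable_one_add_of_summable ?_
    simpa using hun.mul_left ‖c‖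
  have key : ∀ c : ℂ, ‖c‖ ≤ 1 → c ≠ 0 →
      (PP u c - 1) / c = ∑' n, u n * ∏ i ∈ range n, (1 + c * u i) := by
    intro c hc hc0
    have hs : Summable fun n => u n * ∏ i ∈ range n, (1 + c * u i) := by
      refine Summable.of_norm_bounded (hun.mul_right (Real.exp (∑' i, ‖u i‖))) fun n => ?_
      rw [norm_mul]
      exact mul_le_mul_of_nonneg_left (hP c hc n) (norm_nonneg _)
    have h1 := hs.hasSum.tendsto_sum_nat
    have h2 : Filter.Tendsto (fun N => (∏ i ∈ range N, (1 + c * u i) - 1) / c) Filter.atTop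
        (nhds ((PP u c - 1) / c)) :=
      (((hm c).hasProd.tendsto_prod_nat).sub_const 1).div_const c
    refine tendsto_nhds_unique h2 (h1.congr fun N => ?_)
    induction N with
    | zero => simp
    | succ N ih =>
      rw [Finset.sum_range_succ, Finset.prod_range_succ, ih]
      field_simp
      ring
  have hlev : ∀ᶠ m in Filter.atTop, ‖l m‖ ≤ 1 := by
    have := (tendsto_norm_zero.comp hl).eventually (ge_mem_nhds (by norm_num : (0 : ℝ) < 1))
    simpa using this
  have T := tendsto_tsum_of_dominated_convergence (𝓕 := Filter.atTop)
    (f := fun (m : ℕ) (n : ℕ) => u n * ∏ i ∈ range n, (1 + l m * u i)) (g := u)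
    (bound := fun n => ‖u n‖ * Real.exp (∑' i, ‖u i‖)) (hun.mul_right _) (by
      intro n
      have : Filter.Tendsto (fun m => ∏ i ∈ range n, (1 + l m * u i)) Filter.atTop
          (nhds (∏ i ∈ range n, (1 + 0 * u i))) :=
        tendsto_finsetProd _ fun i _ => (hl.mul_const _).const_add _
      simpa using this.const_mul (u n)) (by
      filter_upwards [hlev] with m hm n
      rw [norm_mul]
      exact mul_le_mul_of_nonneg_left (hP _ hm n) (norm_nonneg _))
  refine T.congr' ?_
  filter_upwards [hlev] with m hm
  exact (key _ hm (hl0 m)).symm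

lemma PP_lim1 {u : ℕ → ℂ} (hu : Summable u) {l : ℕ → ℂ} (hl : Filter.Tendsto l Filter.atTop (nhds 0))
    (hl0 : ∀ m, l m ≠ 0) :
    Filter.Tendsto (fun m => PP u (l m)) Filter.atTop (nhds 1) := by
  have := ((PP_lim hu hl hl0).mul hl).add_const 1
  rw [mul_zero, zero_add] at this
  refine this.congr fun m => ?_
  have := hl0 m
  field_simp
  ring

lemma poch_pair {w Q b : ℂ} (hQ : ‖Q‖ < 1) (hb : b ≠ 0) (h : ∀ n : ℕ, w * Q ^ n ≠ 1) :
    poch (b * w) Q * poch (w / b) Q =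
      poch w Q ^ 2 * PP (fun n => ss (w * Q ^ n)) (2 - b - b⁻¹) := by
  have hm : Multipliable fun n : ℕ => 1 + (2 - b - b⁻¹) * ss (w * Q ^ n) := by
    refine multipliable_one_add_of_summable ?_
    simpa using (ss_summable w hQ).norm.mul_left ‖2 - b - b⁻¹‖
  unfold PP poch
  rw [sq, ← Multipliable.tprod_mul (mult_poch w hQ) (mult_poch w hQ),
    ← Multipliable.tprod_mul (mult_poch _ hQ) (mult_poch _ hQ),
    ← Multipliable.tprod_mul ((mult_poch w hQ).mul (mult_poch w hQ)) hm]
  refine tprod_congr fun n => ?_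
  have : 1 - w * Q ^ n ≠ 0 := fun h0 => h n (by linear_combination -h0)
  unfold ss
  field_simp
  ring


noncomputable def tht (Q z : ℂ) : ℂ := poch z Q * poch (Q / z) Q

lemma inv_cond {Q z : ℂ} (h : ∀ n : ℤ, z * Q ^ n ≠ 1) (n : ℕ) :
    Q / z * Q ^ n ≠ 1 := by
  intro h1
  apply h (-((n : ℤ) + 1))
  rw [zpow_neg, zpow_add_one₀' n, zpow_natCast, ← inv_eq_one, mul_inv, inv_inv, ← h1]
  ring

lemma nat_cond {Q z : ℂ} (h : ∀ n : ℤ, z * Q ^ n ≠ 1) (n : ℕ) : z * Q ^ n ≠ 1 := by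
  exact_mod_cast h n

lemma tht_ne {Q z : ℂ} (hQ : ‖Q‖ < 1) (h : ∀ n : ℤ, z * Q ^ n ≠ 1) : tht Q z ≠ 0 :=
  mul_ne_zero (poch_ne_zero hQ (nat_cond h)) (poch_ne_zero hQ (inv_cond h))

lemma JJ_eq {Q : ℂ} (hQ : ‖Q‖ < 1) (z : ℂ) :
    JJ Q z = ∑' n : ℕ, ss (z * Q ^ n) + ∑' n : ℕ, ss (Q / z * Q ^ n) :=
  (bilateral_hasSum ss_inv (fun w => ss_summable w hQ)).tsum_eq

lemma JJ_summable {Q : ℂ} (hQ : ‖Q‖ < 1) (z : ℂ) : Summable fun n : ℤ => ss (z * Q ^ n) :=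
  (bilateral_hasSum ss_inv (fun w => ss_summable w hQ)).summable

lemma Th_tht {p a : ℂ} (hp0 : p ≠ 0) (hp : ‖p‖ < 1) (ha : a ≠ 0) :
    Th a p = poch (p ^ 2) (p ^ 2) * tht (p ^ 2) (-(p * a)) := by
  rw [Th_eq hp0 hp ha, tht, mul_assoc]
  congr 2
  · congr 1; ring
  · congr 1; field_simp

lemma Th_pair {p a b : ℂ} (hp0 : p ≠ 0) (hp : ‖p‖ < 1) (ha : a ≠ 0) (hb : b ≠ 0)
    (h : ∀ n : ℤ, -(p * a) * (p ^ 2) ^ n ≠ 1) :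
    Th (a * b) p * Th (a / b) p = Th a p ^ 2 *
      (PP (fun n => ss (-(p * a) * (p ^ 2) ^ n)) (2 - b - b⁻¹) *
       PP (fun n => ss (p ^ 2 / -(p * a) * (p ^ 2) ^ n)) (2 - b - b⁻¹)) := by
  have hQ := norm_sq_lt hp
  rw [Th_tht hp0 hp ha, Th_tht hp0 hp (mul_ne_zero ha hb), Th_tht hp0 hp (div_ne_zero ha hb)]
  have h1 := poch_pair hQ hb (nat_cond h)
  have h2 := poch_pair hQ hb (inv_cond h)
  unfold tht
  rw [show -(p * (a * b)) = b * -(p * a) by ring, show -(p * (a / b)) = -(p * a) / b by ring,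
    show p ^ 2 / (b * -(p * a)) = p ^ 2 / -(p * a) / b by field_simp,
    show p ^ 2 / (-(p * a) / b) = b * (p ^ 2 / -(p * a)) by field_simp]
  linear_combination (poch (p ^ 2) (p ^ 2)) ^ 2 * (poch (p ^ 2 / -(p * a) / b) (p ^ 2) *
    poch (b * (p ^ 2 / -(p * a))) (p ^ 2)) * h1 + (poch (p ^ 2) (p ^ 2)) ^ 2 *
    (poch (-(p * a)) (p ^ 2) ^ 2 * PP (fun n => ss (-(p * a) * (p ^ 2) ^ n)) (2 - b - b⁻¹)) * h2

/-- The exact version before taking the limit. -/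
lemma J_exact {p a w b : ℂ} (hp0 : p ≠ 0) (hp : ‖p‖ < 1) (ha : a ≠ 0) (hw : w ≠ 0) (hb : b ≠ 0) :
    (Th (a * b) p * Th (a / b) p) * Th w p ^ 2 - (Th (w * b) p * Th (w / b) p) * Th a p ^ 2 =
    p * (Th (-(p * b)) p * Th (-(b / p)) p) * (w * (Th (-(p * (a * w))) p * Th (-(a / (p * w))) p)) := by
  have a1 := addition hp0 hp ha hb
  have a2 := addition hp0 hp hw hb
  have a3 := addition hp0 hp ha one_ne_zero
  have a4 := addition hp0 hp hw one_ne_zero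
  have c1 := cross hp0 hp ha hw
  have c2 := cross hp0 hp hb one_ne_zero
  simp only [mul_one, div_one, one_mul] at a3 a4 c2
  rw [← c1, ← c2, a1, a2, sq, sq, a3, a4]
  ring

theorem J_diff {Q z v : ℂ} (hQ0 : Q ≠ 0) (hQ : ‖Q‖ < 1) (hz0 : z ≠ 0) (hv0 : v ≠ 0)
    (hz : ∀ n : ℤ, z * Q ^ n ≠ 1) (hv : ∀ n : ℤ, v * Q ^ n ≠ 1) :
    (JJ Q z - JJ Q v) * (tht Q z ^ 2 * tht Q v ^ 2) =
      -v * poch Q Q ^ 4 * (tht Q (z * v) * tht Q (z / v)) := by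
  obtain ⟨p, hp2⟩ : ∃ p : ℂ, p ^ 2 = Q := ⟨Q ^ (1 / 2 : ℂ), by
    rw [← Complex.cpow_nat_mul]; norm_num⟩
  have hp0 : p ≠ 0 := fun h => hQ0 (by rw [← hp2, h]; simp)
  have hp : ‖p‖ < 1 := by
    have h1 : ‖p‖ ^ 2 < 1 := by rw [← norm_pow, hp2]; exact hQ
    by_contra hcon
    push Not at hcon
    nlinarith
  subst hp2
  obtain ⟨a, ha, rfl⟩ : ∃ a : ℂ, a ≠ 0 ∧ z = -(p * a) := ⟨-(z / p), by
    simp [hz0, hp0], by field_simp⟩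
  obtain ⟨w, hw, rfl⟩ : ∃ a : ℂ, a ≠ 0 ∧ v = -(p * a) := ⟨-(v / p), by
    simp [hv0, hp0], by field_simp⟩
  set Q := p ^ 2 with hQdef
  have hE : poch Q Q ≠ 0 := pochQQ_ne hQ
  let b : ℕ → ℂ := fun m => 1 + 1 / ((m : ℂ) + 1)
  have hb0 : ∀ m, b m ≠ 0 := fun m => by
    have h1 : (m : ℂ) + 1 ≠ 0 := by exact_mod_cast Nat.succ_ne_zero m
    have h2 : (m : ℂ) + 1 + 1 ≠ 0 := by exact_mod_cast Nat.succ_ne_zero (m + 1)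
    simp only [b]
    rw [show 1 + 1 / ((m : ℂ) + 1) = ((m : ℂ) + 1 + 1) / (m + 1) by field_simp]
    exact div_ne_zero h2 h1
  have hbt : Filter.Tendsto b Filter.atTop (nhds 1) := by
    have := (tendsto_one_div_add_atTop_nhds_zero_nat (𝕜 := ℂ)).const_add 1
    simpa [b] using this
  let l : ℕ → ℂ := fun m => 2 - b m - (b m)⁻¹
  have hl : Filter.Tendsto l Filter.atTop (nhds 0) := by
    have := (hbt.const_sub 2).sub (hbt.inv₀ one_ne_zero)
    have e : (2 - 1 - (1 : ℂ)⁻¹) = 0 := by norm_num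
    rw [e] at this
    exact this
  have hl0 : ∀ m, l m ≠ 0 := fun m => by
    have h1 : (m : ℂ) + 1 ≠ 0 := by exact_mod_cast Nat.succ_ne_zero m
    have h2 : l m = -(b m - 1) ^ 2 / b m := by
      have := hb0 m
      simp only [l]; field_simp; ring
    rw [h2]
    refine div_ne_zero (neg_ne_zero.mpr (pow_ne_zero _ ?_)) (hb0 m)
    simp only [b, add_sub_cancel_left]
    exact one_div_ne_zero h1
  -- the sequences
  set u1 : ℕ → ℂ := fun n => ss (-(p * a) * Q ^ n) with hu1
  set u2 : ℕ → ℂ := fun n => ss (Q / -(p * a) * Q ^ n) with hu2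
  set w1 : ℕ → ℂ := fun n => ss (-(p * w) * Q ^ n) with hw1
  set w2 : ℕ → ℂ := fun n => ss (Q / -(p * w) * Q ^ n) with hw2
  set r : ℕ → ℂ := fun n => ss (Q * Q ^ n) with hr
  have su1 : Summable u1 := ss_summable _ hQ
  have su2 : Summable u2 := ss_summable _ hQ
  have sw1 : Summable w1 := ss_summable _ hQ
  have sw2 : Summable w2 := ss_summable _ hQ
  have sr : Summable r := ss_summable _ hQ
  have hJz : JJ Q (-(p * a)) = ∑' n, u1 n + ∑' n, u2 n := JJ_eq hQ _
  have hJv : JJ Q (-(p * w)) = ∑' n, w1 n + ∑' n, w2 n := JJ_eq hQ _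
  have exact1 : ∀ m, (PP u1 (l m) * PP u2 (l m) - PP w1 (l m) * PP w2 (l m)) *
      (tht Q (-(p * a)) ^ 2 * tht Q (-(p * w)) ^ 2) =
      l m * (PP r (l m) ^ 2 * (-(-(p * w)) * poch Q Q ^ 4 *
        (tht Q (-(p * a) * -(p * w)) * tht Q (-(p * a) / -(p * w))))) := by
    intro m
    have hbm := hb0 m
    have J0 := J_exact hp0 hp ha hw hbm
    rw [Th_pair hp0 hp ha hbm hz, Th_pair hp0 hp hw hbm hv] at J0
    have hb1 : Th (-(p * b m)) p * Th (-(b m / p)) p = l m * (poch Q Q ^ 6 * PP r (l m) ^ 2) := by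
      have pr := poch_pair (w := Q) hQ hbm (fun n h => one_sub_pow_ne hQ n (by rw [h]; ring))
      rw [Th_tht hp0 hp (neg_ne_zero.mpr (mul_ne_zero hp0 hbm)),
        Th_tht hp0 hp (neg_ne_zero.mpr (div_ne_zero hbm hp0))]
      unfold tht
      rw [show -(p * -(p * b m)) = b m * Q by rw [hQdef]; ring,
        show -(p * -(b m / p)) = b m by field_simp,
        show p ^ 2 / (b m * Q) = (b m)⁻¹ by rw [hQdef]; field_simp, ← hQdef,
        poch_succ (b m) hQ, poch_succ (b m)⁻¹ hQ, show (b m)⁻¹ * Q = Q / b m by ring]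
      have e : (1 - (b m)⁻¹) * (1 - b m) = l m := by simp only [l]; field_simp; ring
      have e2 : PP r (l m) = PP (fun n => ss (Q * Q ^ n)) (2 - b m - (b m)⁻¹) := rfl
      rw [e2, ← e]
      linear_combination poch Q Q ^ 2 * ((1 - (b m)⁻¹) * (1 - b m)) *
        (poch (b m * Q) Q * poch (Q / b m) Q + poch Q Q ^ 2 *
          PP (fun n => ss (Q * Q ^ n)) (2 - b m - (b m)⁻¹)) * pr
    rw [hb1, Th_tht hp0 hp ha, Th_tht hp0 hp hw,
      Th_tht hp0 hp (neg_ne_zero.mpr (mul_ne_zero hp0 (mul_ne_zero ha hw))),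
      Th_tht hp0 hp (neg_ne_zero.mpr (div_ne_zero ha (mul_ne_zero hp0 hw))), ← hQdef,
      show -(p * -(p * (a * w))) = -(p * a) * -(p * w) by ring,
      show -(p * -(a / (p * w))) = -(p * a) / -(p * w) by field_simp] at J0
    refine mul_left_cancel₀ (pow_ne_zero 4 hE) ?_
    linear_combination J0
  have T1 : Filter.Tendsto (fun m => (PP u1 (l m) * PP u2 (l m) - PP w1 (l m) * PP w2 (l m)) / l m)
      Filter.atTop (nhds (JJ Q (-(p * a)) - JJ Q (-(p * w)))) := by
    have A := ((PP_lim su1 hl hl0).mul (PP_lim1 su2 hl hl0)).add (PP_lim su2 hl hl0)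
    have B := ((PP_lim sw1 hl hl0).mul (PP_lim1 sw2 hl hl0)).add (PP_lim sw2 hl hl0)
    have := A.sub B
    rw [mul_one, mul_one, ← hJz, ← hJv] at this
    refine this.congr fun m => ?_
    ring
  have T2 := T1.mul_const (tht Q (-(p * a)) ^ 2 * tht Q (-(p * w)) ^ 2)
  have T3 := ((PP_lim1 sr hl hl0).pow 2).mul_const (-(-(p * w)) * poch Q Q ^ 4 *
        (tht Q (-(p * a) * -(p * w)) * tht Q (-(p * a) / -(p * w))))
  rw [one_pow, one_mul] at T3
  refine tendsto_nhds_unique T2 (T3.congr fun m => ?_)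
  have := exact1 m
  have h := hl0 m
  rw [div_mul_eq_mul_div, this]
  field_simp

end RF7

namespace RF7

noncomputable def ssq (z : ℂ) : ℂ := 6 * ss z ^ 2 + ss z

lemma ssq_inv (z : ℂ) : ssq z⁻¹ = ssq z := by simp [ssq, ss_inv]

lemma ssq_bound (x : ℂ) (hx : ‖x‖ ≤ 1 / 2) : ‖ssq x‖ ≤ 100 * ‖x‖ := by
  have h := ss_bound x hx
  have h0 := norm_nonneg (ss x)
  have h1 := norm_nonneg x
  calc ‖ssq x‖ ≤ ‖6 * ss x ^ 2‖ + ‖ss x‖ := norm_add_le _ _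
    _ = 6 * ‖ss x‖ ^ 2 + ‖ss x‖ := by simp
    _ ≤ _ := by nlinarith

lemma ssq_summable (w : ℂ) {Q : ℂ} (hQ : ‖Q‖ < 1) : Summable fun n : ℕ => ssq (w * Q ^ n) :=
  summable_geom_comp ssq_bound w hQ

noncomputable def KK (Q z : ℂ) : ℂ := ∑' n : ℤ, ssq (z * Q ^ n)

lemma KK_eq {Q : ℂ} (hQ : ‖Q‖ < 1) (z : ℂ) :
    KK Q z = ∑' n : ℕ, ssq (z * Q ^ n) + ∑' n : ℕ, ssq (Q / z * Q ^ n) :=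
  (bilateral_hasSum ssq_inv (fun w => ssq_summable w hQ)).tsum_eq

lemma KK_summable {Q : ℂ} (hQ : ‖Q‖ < 1) (z : ℂ) : Summable fun n : ℤ => ssq (z * Q ^ n) :=
  (bilateral_hasSum ssq_inv (fun w => ssq_summable w hQ)).summable

noncomputable def SS (Q : ℂ) : ℂ := ∑' n : ℕ, ss (Q * Q ^ n)

lemma SS_hasSum {Q : ℂ} (hQ : ‖Q‖ < 1) : HasSum (fun n : ℕ => ss (Q * Q ^ n)) (SS Q) :=
  (ss_summable Q hQ).hasSum

lemma JJ_one {Q : ℂ} (hQ : ‖Q‖ < 1) : JJ Q 1 = 2 * SS Q := by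
  rw [JJ_eq hQ, (ss_summable 1 hQ).tsum_eq_zero_add]
  simp only [SS, div_one, one_mul, pow_succ', pow_zero]
  simp [ss]
  ring

lemma gg_bound (x : ℂ) (hx : ‖x‖ ≤ 1 / 2) : ‖x / (1 - x)‖ ≤ 2 * ‖x‖ := by
  have h := norm_one_sub_ge hx
  rw [norm_div, div_le_iff₀ (by linarith)]
  nlinarith [norm_nonneg x]

lemma G_summable {Q z v : ℂ} (hQ0 : Q ≠ 0) (hQ : ‖Q‖ < 1) (hz0 : z ≠ 0) (hv0 : v ≠ 0)
    (hz : ∀ n : ℤ, z * Q ^ n ≠ 1) (hv : ∀ n : ℤ, v * Q ^ n ≠ 1) :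
    Summable fun n : ℤ => (1 - z * Q ^ n)⁻¹ - (1 - v * Q ^ n)⁻¹ := by
  have pos : ∀ z : ℂ, (∀ n : ℤ, z * Q ^ n ≠ 1) → ∀ n : ℤ,
      (1 - z * Q ^ n)⁻¹ = 1 + z * Q ^ n / (1 - z * Q ^ n) := by
    intro z hz n
    have : 1 - z * Q ^ n ≠ 0 := fun h0 => hz n (by linear_combination -h0)
    field_simp
    ring
  have neg : ∀ z : ℂ, z ≠ 0 → (∀ n : ℤ, z * Q ^ n ≠ 1) → ∀ n : ℕ,
      (1 - z * Q ^ (-((n : ℤ) + 1)))⁻¹ = -(Q / z * Q ^ n / (1 - Q / z * Q ^ n)) := by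
    intro z hz0 hz n
    have h1 := hz (-((n : ℤ) + 1))
    have h2 := inv_cond hz n
    have e : z * Q ^ (-((n : ℤ) + 1)) = (Q / z * Q ^ n)⁻¹ := by
      rw [zpow_neg, zpow_add_one₀' n, zpow_natCast]; field_simp
    rw [e] at h1 ⊢
    have hx : Q / z * Q ^ n ≠ 0 := mul_ne_zero (div_ne_zero hQ0 hz0) (pow_ne_zero _ hQ0)
    set x := Q / z * Q ^ n
    have h3 : 1 - x ≠ 0 := fun h0 => h2 (by linear_combination -h0)
    have h4 : x - 1 ≠ 0 := fun h0 => h2 (by linear_combination h0)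
    rw [show 1 - x⁻¹ = (x - 1) / x by field_simp, inv_div, ← div_neg, neg_sub]
  refine Summable.of_nat_of_neg_add_one ?_ ?_
  · have := (summable_geom_comp gg_bound z hQ).sub (summable_geom_comp gg_bound v hQ)
    refine this.congr fun n => ?_
    rw [pos z hz, pos v hv]
    simp
  · have := (summable_geom_comp gg_bound (Q / v) hQ).sub (summable_geom_comp gg_bound (Q / z) hQ)
    refine this.congr fun n => ?_
    rw [neg z hz0 hz, neg v hv0 hv]
    ring

lemma partial_frac {a t : ℂ} (ha : a ≠ 1) (ht : t ≠ 1) (hat : a * t ≠ 1) :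
    ss a * ss (a * t) = ss t * (ss a + ss (a * t)) -
      t * (1 + t) / (1 - t) ^ 3 * ((1 - a)⁻¹ - (1 - a * t)⁻¹) := by
  have h1 : 1 - a ≠ 0 := fun h0 => ha (by linear_combination -h0)
  have h2 : 1 - t ≠ 0 := fun h0 => ht (by linear_combination -h0)
  have h3 : 1 - a * t ≠ 0 := fun h0 => hat (by linear_combination -h0)
  unfold ss
  field_simp
  ring

lemma zpow_ne_one {Q : ℂ} (hQ0 : Q ≠ 0) (hQ : ‖Q‖ < 1) {k : ℤ} (hk : k ≠ 0) : Q ^ k ≠ 1 := by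
  have key : ∀ n : ℕ, n ≠ 0 → Q ^ n ≠ 1 := fun n hn h => by
    have := norm_pow_lt hQ hn
    rw [h] at this; simp at this
  obtain ⟨n, rfl | rfl⟩ := k.eq_nat_or_neg
  · have := key n (by rintro rfl; simp at hk)
    exact_mod_cast this
  · have := key n (by rintro rfl; simp at hk)
    rw [zpow_neg]
    intro h
    exact this (by exact_mod_cast inv_eq_one.mp h)

lemma fiber {Q z v : ℂ} (hQ0 : Q ≠ 0) (hQ : ‖Q‖ < 1) (hz0 : z ≠ 0) (hv0 : v ≠ 0)
    (hz : ∀ n : ℤ, z * Q ^ n ≠ 1) (hv : ∀ n : ℤ, v * Q ^ n ≠ 1) {k : ℤ} (hk : k ≠ 0) :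
    HasSum (fun n : ℤ => ss (z * Q ^ n) * ss (z * Q ^ (n + k)) -
      ss (v * Q ^ n) * ss (v * Q ^ (n + k))) (2 * ss (Q ^ k) * (JJ Q z - JJ Q v)) := by
  have hJz := (JJ_summable hQ z).hasSum
  have hJv := (JJ_summable hQ v).hasSum
  have hG := (G_summable hQ0 hQ hz0 hv0 hz hv).hasSum
  have hJz' := (Equiv.hasSum_iff (Equiv.addRight k)).mpr hJz
  have hJv' := (Equiv.hasSum_iff (Equiv.addRight k)).mpr hJv
  have hG' := (Equiv.hasSum_iff (Equiv.addRight k)).mpr hG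
  have := (((hJz.add hJz').sub (hJv.add hJv')).mul_left (ss (Q ^ k))).sub
    ((hG.sub hG').mul_left (Q ^ k * (1 + Q ^ k) / (1 - Q ^ k) ^ 3))
  refine hs_congr this (fun n => ?_) ?_
  · have ht := zpow_ne_one hQ0 hQ hk
    have e : ∀ z : ℂ, z * Q ^ (n + k) = z * Q ^ n * Q ^ k := fun z => by
      rw [zpow_add₀ hQ0]; ring
    have h1 := partial_frac (hz n) ht (by rw [← e]; exact hz _)
    have h2 := partial_frac (hv n) ht (by rw [← e]; exact hv _)
    simp only [Function.comp, Equiv.coe_addRight]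
    rw [e, e, h1, h2]
    ring
  · simp only [JJ]; ring

theorem ode {Q z v : ℂ} (hQ0 : Q ≠ 0) (hQ : ‖Q‖ < 1) (hz0 : z ≠ 0) (hv0 : v ≠ 0)
    (hz : ∀ n : ℤ, z * Q ^ n ≠ 1) (hv : ∀ n : ℤ, v * Q ^ n ≠ 1) :
    KK Q z - KK Q v = (JJ Q z - JJ Q v) * (6 * (JJ Q z + JJ Q v) + 1 - 24 * SS Q) := by
  have hJz := (JJ_summable hQ z).hasSum
  have hJv := (JJ_summable hQ v).hasSum
  have hKz := (KK_summable hQ z).hasSum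
  have hKv := (KK_summable hQ v).hasSum
  let e : ℤ × ℤ ≃ ℤ × ℤ :=
    { toFun := fun x => (x.2, x.2 + x.1)
      invFun := fun x => (x.2 - x.1, x.1)
      left_inv := fun x => by simp
      right_inv := fun x => by simp }
  have P := (mul_hasSum hJz hJz).sub (mul_hasSum hJv hJv)
  have P' := e.hasSum_iff.mpr P
  have R0 : HasSum (fun n : ℤ => ss (z * Q ^ n) * ss (z * Q ^ (n + 0)) -
      ss (v * Q ^ n) * ss (v * Q ^ (n + 0)))
      ((KK Q z - KK Q v - (JJ Q z - JJ Q v)) / 6) := by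
    refine hs_congr (((hKz.sub hKv).sub (hJz.sub hJv)).div_const 6) (fun n => ?_) rfl
    simp only [ssq, add_zero]; ring
  have F := P'.prod_fiberwise (g := fun k : ℤ => 2 * ss (Q ^ k) * (JJ Q z - JJ Q v) +
      (if k = 0 then ((KK Q z - KK Q v - (JJ Q z - JJ Q v)) / 6) else 0)) (by
    intro k
    by_cases hk : k = 0
    · subst hk
      simp only [zpow_zero, if_true]
      rw [show 2 * ss 1 * (JJ Q z - JJ Q v) = 0 by simp [ss], zero_add]
      exact R0
    · simp only [hk, if_false, add_zero]
      exact fiber hQ0 hQ hz0 hv0 hz hv hk)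
  have S1 := (JJ_summable hQ 1).hasSum
  have F' := ((S1.mul_left 2).mul_right (JJ Q z - JJ Q v)).add
    (hasSum_ite_eq (0 : ℤ) ((KK Q z - KK Q v - (JJ Q z - JJ Q v)) / 6))
  simp only [one_mul] at F'
  have U := F.unique F'
  have h1 := JJ_one hQ
  simp only [JJ, one_mul] at h1
  rw [h1] at U
  change JJ Q z * JJ Q z - JJ Q v * JJ Q v = _ at U
  linear_combination -6 * U

end RF7

namespace RF7

noncomputable def EE (q : ℂ) : ℂ := poch q q
noncomputable def ph (q : ℂ) : ℂ := Th 1 q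

lemma EE_ne {q : ℂ} (hq : ‖q‖ < 1) : EE q ≠ 0 := pochQQ_ne hq

lemma EEn_ne {q : ℂ} (hq : ‖q‖ < 1) {n : ℕ} (hn : n ≠ 0) : EE (q ^ n) ≠ 0 :=
  EE_ne (norm_pow_lt hq hn)

lemma po1 {q : ℂ} (hq : ‖q‖ < 1) : poch q (q ^ 2) = EE q / EE (q ^ 2) := by
  have h := poch_even_odd q hq
  have := EEn_ne hq two_ne_zero
  rw [eq_div_iff this]
  rw [show q * q = q ^ 2 by ring] at h
  exact h.symm

lemma po2 {q : ℂ} (hq : ‖q‖ < 1) : poch (-q) (q ^ 2) = EE (q ^ 2) ^ 2 / (EE q * EE (q ^ 4)) := by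
  have h := poch_mul_neg q (norm_sq_lt hq)
  have h1 := po1 hq
  have h2 := po1 (norm_sq_lt hq)
  rw [← pow_mul] at h h2
  rw [h1, h2] at h
  have e1 := EE_ne hq
  have e2 := EEn_ne hq two_ne_zero
  have e4 := EEn_ne hq four_ne_zero
  norm_num at h
  field_simp at h ⊢
  linear_combination h

lemma po3 {q : ℂ} (hq : ‖q‖ < 1) : poch (-q) q = EE (q ^ 2) / EE q := by
  have h := poch_mul_neg q hq
  rw [eq_div_iff (EE_ne hq), mul_comm]
  exact h

lemma ph_eq {q : ℂ} (hq0 : q ≠ 0) (hq : ‖q‖ < 1) :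
    ph q = EE (q ^ 2) ^ 5 / (EE q ^ 2 * EE (q ^ 4) ^ 2) := by
  rw [ph, Th_eq hq0 hq one_ne_zero, one_mul, div_one, po2 hq]
  have e1 := EE_ne hq
  have e2 := EEn_ne hq two_ne_zero
  have e4 := EEn_ne hq four_ne_zero
  change EE (q ^ 2) * _ * _ = _
  field_simp

lemma ph_neg_eq {q : ℂ} (hq0 : q ≠ 0) (hq : ‖q‖ < 1) : ph (-q) = EE q ^ 2 / EE (q ^ 2) := by
  rw [ph, Th_eq (neg_ne_zero.mpr hq0) (by simpa using hq) one_ne_zero, one_mul, div_one, neg_neg,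
    neg_sq, po1 hq]
  have e1 := EE_ne hq
  have e2 := EEn_ne hq two_ne_zero
  change EE (q ^ 2) * _ * _ = _
  field_simp

lemma poch_neg_one {q : ℂ} (hq : ‖q‖ < 1) : poch (-1) q = 2 * (EE (q ^ 2) / EE q) := by
  rw [poch_succ _ hq, neg_one_mul, po3 hq]; ring

lemma oo_one {q : ℂ} (hq0 : q ≠ 0) (hq : ‖q‖ < 1) : oo 1 q = 2 * EE (q ^ 8) ^ 2 / EE (q ^ 4) := by
  have hq2 : q ^ 2 ≠ 0 := pow_ne_zero _ hq0
  have hq4 := norm_pow_lt hq four_ne_zero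
  rw [oo, one_mul, one_mul, Th_eq hq2 (norm_sq_lt hq) hq2, div_self hq2, ← pow_mul,
    show q ^ 2 * q ^ 2 = q ^ 4 by ring, show 2 * 2 = 4 by norm_num, po3 hq4, poch_neg_one hq4,
    ← pow_mul]
  have e4 := EEn_ne hq four_ne_zero
  change EE (q ^ 4) * _ * _ = _
  norm_num
  field_simp

lemma rel_sq {q : ℂ} (hq0 : q ≠ 0) (hq : ‖q‖ < 1) :
    ph q ^ 2 = ph (q ^ 2) ^ 2 + q * (2 * EE (q ^ 8) ^ 2 / EE (q ^ 4)) ^ 2 := by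
  have := addition hq0 hq one_ne_zero one_ne_zero
  rw [oo_one hq0 hq, ee, one_mul, div_one, one_pow] at this
  change ph q * ph q = ph (q ^ 2) * ph (q ^ 2) + _ at this
  linear_combination this

lemma rel_sq_neg {q : ℂ} (hq0 : q ≠ 0) (hq : ‖q‖ < 1) :
    ph (-q) ^ 2 = ph (q ^ 2) ^ 2 - q * (2 * EE (q ^ 8) ^ 2 / EE (q ^ 4)) ^ 2 := by
  have := rel_sq (neg_ne_zero.mpr hq0) (by simpa using hq)
  rw [neg_sq, Even.neg_pow (by decide : Even 8), Even.neg_pow (by decide : Even 4)] at this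
  rw [this]; ring

lemma rel_add {q : ℂ} (hq0 : q ≠ 0) (hq : ‖q‖ < 1) :
    ph q ^ 2 + ph (-q) ^ 2 = 2 * ph (q ^ 2) ^ 2 := by
  rw [rel_sq hq0 hq, rel_sq_neg hq0 hq]; ring

lemma rel_sub {q : ℂ} (hq0 : q ≠ 0) (hq : ‖q‖ < 1) :
    ph q ^ 2 - ph (-q) ^ 2 = 8 * q * EE (q ^ 8) ^ 4 / EE (q ^ 4) ^ 2 := by
  rw [rel_sq hq0 hq, rel_sq_neg hq0 hq]; ring

lemma rel_mul {q : ℂ} (hq0 : q ≠ 0) (hq : ‖q‖ < 1) :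
    ph q * ph (-q) = ph (-q ^ 2) ^ 2 := by
  rw [ph_eq hq0 hq, ph_neg_eq hq0 hq, ph_neg_eq (pow_ne_zero 2 hq0) (norm_sq_lt hq), ← pow_mul]
  have e1 := EE_ne hq
  have e2 := EEn_ne hq two_ne_zero
  have e4 := EEn_ne hq four_ne_zero
  norm_num
  field_simp

lemma rel_half {q : ℂ} (hq0 : q ≠ 0) (hq : ‖q‖ < 1) :
    ph q + ph (-q) = 2 * ph (q ^ 4) := by
  have h1 := Th_hasSum hq0 hq one_ne_zero
  have h2 := Th_hasSum (neg_ne_zero.mpr hq0) (by simpa using hq) one_ne_zero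
  have h4 := (Th_hasSum (pow_ne_zero 4 hq0) (norm_pow_lt hq four_ne_zero) one_ne_zero).mul_left 2
  have h := h1.add h2
  have inj : Function.Injective (fun k : ℤ => 2 * k) := fun a b hab => by
    simp only at hab; omega
  have := (inj.hasSum_iff (f := fun k : ℤ => 1 ^ k * q ^ k ^ 2 + 1 ^ k * (-q) ^ k ^ 2) (by
    intro k hk
    have hodd : Odd k := by
      rcases Int.even_or_odd k with ⟨m, hm⟩ | h
      · exact absurd ⟨m, by simp only; omega⟩ hk
      · exact h
    have : Odd (k ^ 2) := hodd.pow
    simp only [one_zpow, one_mul, this.neg_zpow, add_neg_cancel])).mpr h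
  refine this.unique (hs_congr h4 (fun k => ?_) rfl)
  have ev : Even ((2 * k) ^ 2) := ⟨2 * k ^ 2, by ring⟩
  simp only [Function.comp, one_zpow, one_mul, ev.neg_zpow]
  rw [← zpow_natCast q 4, ← zpow_mul]
  rw [show (((4 : ℕ) : ℤ) * k ^ 2) = (2 * k) ^ 2 by push_cast; ring]
  ring

lemma mono_W1 {q : ℂ} (hq0 : q ≠ 0) (hq : ‖q‖ < 1) :
    q * EE (q ^ 8) ^ 2 * EE (q ^ 4) * EE (q ^ 2) ^ 3 / EE q ^ 2 =
      ph (q ^ 2) * ph q * (ph q ^ 2 - ph (-q) ^ 2) / 8 := by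
  rw [rel_sub hq0 hq, ph_eq hq0 hq, ph_eq (pow_ne_zero 2 hq0) (norm_sq_lt hq), ← pow_mul, ← pow_mul]
  have e1 := EE_ne hq
  have e2 := EEn_ne hq two_ne_zero
  have e4 := EEn_ne hq four_ne_zero
  have e8 := EEn_ne hq (show 8 ≠ 0 by norm_num)
  norm_num
  field_simp

lemma mono_W2 {q : ℂ} (hq0 : q ≠ 0) (hq : ‖q‖ < 1) :
    EE q ^ 2 * EE (q ^ 2) * EE (q ^ 4) ^ 3 / EE (q ^ 8) ^ 2 =
      ph (q ^ 2) * ph q * ph (-q) ^ 2 := by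
  rw [ph_eq hq0 hq, ph_eq (pow_ne_zero 2 hq0) (norm_sq_lt hq), ph_neg_eq hq0 hq, ← pow_mul, ← pow_mul]
  have e1 := EE_ne hq
  have e2 := EEn_ne hq two_ne_zero
  have e4 := EEn_ne hq four_ne_zero
  have e8 := EEn_ne hq (show 8 ≠ 0 by norm_num)
  norm_num
  field_simp

lemma mono_A1 {q : ℂ} (hq0 : q ≠ 0) (hq : ‖q‖ < 1) :
    q * EE (q ^ 2) ^ 11 * EE (q ^ 8) ^ 2 / (EE q ^ 2 * EE (q ^ 4) ^ 3) =
      ph (q ^ 2) * ph q * (ph q * ph (-q)) ^ 2 * (ph q ^ 2 - ph (-q) ^ 2) / 8 := by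
  rw [rel_sub hq0 hq, ph_eq hq0 hq, ph_eq (pow_ne_zero 2 hq0) (norm_sq_lt hq), ph_neg_eq hq0 hq,
    ← pow_mul, ← pow_mul]
  have e1 := EE_ne hq
  have e2 := EEn_ne hq two_ne_zero
  have e4 := EEn_ne hq four_ne_zero
  have e8 := EEn_ne hq (show 8 ≠ 0 by norm_num)
  norm_num
  field_simp

lemma mono_A2 {q : ℂ} (hq0 : q ≠ 0) (hq : ‖q‖ < 1) :
    q * EE q ^ 2 * EE (q ^ 4) ^ 11 / (EE (q ^ 2) ^ 3 * EE (q ^ 8) ^ 2) =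
      ph (q ^ 2) * ph (-q) * (ph q * ph (-q)) * ph (q ^ 2) ^ 2 *
        (ph q ^ 2 - ph (-q) ^ 2) / 8 := by
  rw [rel_sub hq0 hq, ph_eq hq0 hq, ph_eq (pow_ne_zero 2 hq0) (norm_sq_lt hq), ph_neg_eq hq0 hq,
    ← pow_mul, ← pow_mul]
  have e1 := EE_ne hq
  have e2 := EEn_ne hq two_ne_zero
  have e4 := EEn_ne hq four_ne_zero
  have e8 := EEn_ne hq (show 8 ≠ 0 by norm_num)
  norm_num
  field_simp

end RF7

namespace RF7

/-- one-sided sum -/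
noncomputable def gs (w Q : ℂ) : ℂ := ∑' n : ℕ, ss (w * Q ^ n)

lemma gs_split (w : ℂ) {Q : ℂ} (hQ : ‖Q‖ < 1) :
    gs w Q = gs w (Q ^ 2) + gs (w * Q) (Q ^ 2) := by
  unfold gs
  have hQ2 := norm_sq_lt hQ
  have h1 : ∀ n : ℕ, ss (w * Q ^ (2 * n)) = ss (w * (Q ^ 2) ^ n) := fun n => by rw [pow_mul]
  have h2 : ∀ n : ℕ, ss (w * Q ^ (2 * n + 1)) = ss (w * Q * (Q ^ 2) ^ n) := fun n => by
    congr 1; ring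
  rw [← tsum_even_add_odd (f := fun n : ℕ => ss (w * Q ^ n))]
  · simp only [h1, h2]
  · simp only [h1]; exact ss_summable w hQ2
  · simp only [h2]; exact ss_summable _ hQ2

lemma SS_gs (Q : ℂ) : SS Q = gs Q Q := rfl

lemma gs_odd {q : ℂ} (hq : ‖q‖ < 1) : gs q (q ^ 2) = SS q - SS (q ^ 2) := by
  have := gs_split q hq
  rw [SS_gs, SS_gs, this, show q * q = q ^ 2 by ring]; ring

lemma ss_neg {w : ℂ} (h : w ^ 2 ≠ 1) : ss w + ss (-w) = 4 * ss (w ^ 2) := by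
  have h1 : 1 - w ≠ 0 := fun h0 => h (by linear_combination -(1 + w) * h0)
  have h2 : 1 + w ≠ 0 := fun h0 => h (by linear_combination (w - 1) * h0)
  have h3 : 1 - w ^ 2 ≠ 0 := fun h0 => h (by linear_combination - h0)
  unfold ss
  rw [sub_neg_eq_add]
  field_simp
  ring

lemma gs_neg {w Q : ℂ} (hQ : ‖Q‖ < 1) (h : ∀ n : ℕ, (w * Q ^ n) ^ 2 ≠ 1) :
    gs w Q + gs (-w) Q = 4 * gs (w ^ 2) (Q ^ 2) := by
  unfold gs
  rw [← (ss_summable w hQ).tsum_add (ss_summable (-w) hQ), ← tsum_mul_left]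
  refine tsum_congr fun n => ?_
  rw [neg_mul, ss_neg (h n)]
  congr 2
  ring

lemma pow_ne_one_of {q : ℂ} (hq : ‖q‖ < 1) {n : ℕ} (hn : n ≠ 0) : q ^ n ≠ 1 := fun h => by
  have := norm_pow_lt hq hn
  rw [h] at this; simp at this

lemma SS_neg_w {q : ℂ} (hq : ‖q‖ < 1) : gs (-q) q = 4 * SS (q ^ 2) - SS q := by
  have := gs_neg (w := q) hq (fun n => by
    rw [← pow_succ', ← pow_mul]; exact pow_ne_one_of hq (by positivity))
  rw [SS_gs, SS_gs, ← this]; ring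

lemma SS_neg {q : ℂ} (hq : ‖q‖ < 1) : SS (-q) = 6 * SS (q ^ 2) - 4 * SS (q ^ 4) - SS q := by
  have hn : ‖-q‖ < 1 := by simpa using hq
  have h1 := gs_split (-q) hn
  have h2 := gs_neg (w := q) (norm_sq_lt hq) (fun n => by
    rw [← pow_mul, ← pow_succ', ← pow_mul]; exact pow_ne_one_of hq (by positivity))
  have h3 := gs_odd hq
  have h4 := gs_odd (norm_sq_lt hq)
  rw [neg_sq, neg_mul_neg, ← sq, ← SS_gs, ← SS_gs] at h1
  rw [← pow_mul] at h2 h4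
  norm_num at h1 h2 h4
  rw [h4, h3] at h2
  linear_combination h1 + h2

lemma JJ_gs {Q : ℂ} (hQ : ‖Q‖ < 1) (z : ℂ) : JJ Q z = gs z Q + gs (Q / z) Q := JJ_eq hQ z

lemma unit_cond {u Q : ℂ} (hu : ‖u‖ = 1) (hu1 : u ≠ 1) (hQ0 : Q ≠ 0) (hQ : ‖Q‖ < 1) (n : ℤ) :
    u * Q ^ n ≠ 1 := by
  intro h
  by_cases hn : n = 0
  · subst hn; simp at h; exact hu1 h
  · have h1 : ‖Q‖ ^ n = 1 := by
      have := congrArg norm h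
      rwa [norm_mul, hu, one_mul, norm_one, norm_zpow] at this
    have h2 : ((‖Q‖ : ℝ) : ℂ) ^ n = 1 := by exact_mod_cast h1
    exact zpow_ne_one (Q := ((‖Q‖ : ℝ) : ℂ)) (by simpa using hQ0) (by simpa using hQ) hn h2

lemma pow_cond {q : ℂ} (hq0 : q ≠ 0) (hq : ‖q‖ < 1) {a b : ℕ} (h : ¬ b ∣ a) (n : ℤ) :
    q ^ a * (q ^ b) ^ n ≠ 1 := by
  rw [← zpow_natCast q a, ← zpow_natCast q b, ← zpow_mul, ← zpow_add₀ hq0]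
  refine zpow_ne_one hq0 hq fun h0 => h ?_
  have : (b : ℤ) ∣ (a : ℤ) := ⟨-n, by linear_combination h0⟩
  exact_mod_cast this

theorem ph_four {q : ℂ} (hq0 : q ≠ 0) (hq : ‖q‖ < 1) :
    ph q ^ 4 = 1 + 8 * SS q - 32 * SS (q ^ 4) := by
  have hQ := norm_sq_lt hq
  have hQ0 := pow_ne_zero 2 hq0
  have c1 := pow_cond hq0 hq (a := 1) (b := 2) (by norm_num)
  rw [pow_one] at c1
  have D := J_diff hQ0 hQ hq0 (neg_ne_zero.mpr one_ne_zero) c1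
    (unit_cond (by simp) (by norm_num) hQ0 hQ)
  have J1 : JJ (q ^ 2) q = 2 * (SS q - SS (q ^ 2)) := by
    rw [JJ_gs hQ, show q ^ 2 / q = q by field_simp, gs_odd hq]; ring
  have J2 : JJ (q ^ 2) (-1) = -1 / 4 + 2 * (4 * SS (q ^ 4) - SS (q ^ 2)) := by
    have e : gs (-1) (q ^ 2) = -1 / 4 + gs (-q ^ 2) (q ^ 2) := by
      unfold gs
      rw [(ss_summable (-1) hQ).tsum_eq_zero_add]
      congr 1
      · simp [ss]; norm_num
      · refine tsum_congr fun n => ?_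
        congr 1; ring
    rw [JJ_gs hQ, e, show q ^ 2 / (-1) = -q ^ 2 by ring, SS_neg_w hQ, ← pow_mul]
    norm_num
    ring
  have t1 : tht (q ^ 2) q = (EE q / EE (q ^ 2)) ^ 2 := by
    rw [tht, show q ^ 2 / q = q by field_simp, po1 hq]; ring
  have t2 : tht (q ^ 2) (-1) = 2 * (EE (q ^ 4) / EE (q ^ 2)) ^ 2 := by
    rw [tht, show q ^ 2 / (-1) = -q ^ 2 by ring, poch_neg_one hQ, po3 hQ, ← pow_mul]; ring
  have t3 : tht (q ^ 2) (-q) = (EE (q ^ 2) ^ 2 / (EE q * EE (q ^ 4))) ^ 2 := by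
    rw [tht, show q ^ 2 / (-q) = -q by field_simp, po2 hq]; ring
  have e1 := EE_ne hq
  have e2 := EEn_ne hq two_ne_zero
  have e4 := EEn_ne hq four_ne_zero
  rw [show q * -1 = -q by ring, show q / -1 = -q by ring, t1, t2, t3, J1, J2] at D
  change _ = -(-1) * EE (q ^ 2) ^ 4 * _ at D
  rw [ph_eq hq0 hq]
  have key : 2 * (SS q - SS (q ^ 2)) - (-1 / 4 + 2 * (4 * SS (q ^ 4) - SS (q ^ 2))) =
      (EE (q ^ 2) ^ 5 / (EE q ^ 2 * EE (q ^ 4) ^ 2)) ^ 4 / 4 := by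
    set L := 2 * (SS q - SS (q ^ 2)) - (-1 / 4 + 2 * (4 * SS (q ^ 4) - SS (q ^ 2)))
    field_simp at D ⊢
    linear_combination D
  linear_combination -4 * key

theorem ph_neg_four {q : ℂ} (hq0 : q ≠ 0) (hq : ‖q‖ < 1) :
    ph (-q) ^ 4 = 1 - 8 * SS q + 48 * SS (q ^ 2) - 64 * SS (q ^ 4) := by
  rw [ph_four (neg_ne_zero.mpr hq0) (by simpa using hq), SS_neg hq,
    Even.neg_pow (by decide : Even 4)]
  ring

end RF7

namespace RF7

theorem K_first {q : ℂ} (hq0 : q ≠ 0) (hq : ‖q‖ < 1) :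
    KK (q ^ 8) q - KK (q ^ 8) (q ^ 3) =
      ph (q ^ 2) * ph q * (ph q ^ 2 - ph (-q) ^ 2) / 8 *
      (ph q ^ 4 / 2 - ph (-q) ^ 4 / 4 + 3 / 4 * ph (q ^ 2) ^ 4) := by
  have hQ := norm_pow_lt hq (show 8 ≠ 0 by norm_num)
  have hQ0 := pow_ne_zero 8 hq0
  have h2 := norm_sq_lt hq
  have h4 := norm_pow_lt hq four_ne_zero
  have c1 := pow_cond hq0 hq (a := 1) (b := 8) (by norm_num)
  have c3 := pow_cond hq0 hq (a := 3) (b := 8) (by norm_num)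
  rw [pow_one] at c1
  have hq3 := pow_ne_zero 3 hq0
  have D := J_diff hQ0 hQ hq3 hq0 c3 c1
  have O := ode hQ0 hQ hq3 hq0 c3 c1
  have Jsum : JJ (q ^ 8) q + JJ (q ^ 8) (q ^ 3) = SS q - SS (q ^ 2) := by
    have g1 := gs_split q h2
    have g2 := gs_split q h4
    have g3 := gs_split (q ^ 3) h4
    rw [← pow_mul] at g1 g2 g3
    norm_num at g1 g2 g3
    rw [show q * q ^ 2 = q ^ 3 by ring] at g1
    rw [← gs_odd hq, g1, g2, g3, JJ_gs hQ, JJ_gs hQ, show q ^ 8 / q = q ^ 3 * q ^ 4 by field_simp,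
      show q ^ 8 / q ^ 3 = q * q ^ 4 by field_simp]
    ring
  have t1 : tht (q ^ 8) (q ^ 3) * tht (q ^ 8) q = EE q / EE (q ^ 2) := by
    have g1 := poch_even_odd q h2
    have g2 := poch_even_odd q h4
    have g3 := poch_even_odd (q ^ 3) h4
    rw [← pow_mul] at g1 g2 g3
    norm_num at g1 g2 g3
    rw [show q * q ^ 2 = q ^ 3 by ring] at g1
    rw [← po1 hq, g1, g2, g3, tht, tht, show q ^ 8 / q = q ^ 3 * q ^ 4 by field_simp,
      show q ^ 8 / q ^ 3 = q * q ^ 4 by field_simp]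
    ring
  have t2 : tht (q ^ 8) (q ^ 3 * q) = (EE (q ^ 4) / EE (q ^ 8)) ^ 2 := by
    have := po1 h4
    rw [← pow_mul] at this
    norm_num at this
    rw [tht, show q ^ 3 * q = q ^ 4 by ring, show q ^ 8 / q ^ 4 = q ^ 4 by field_simp, this]
    ring
  have t3 : tht (q ^ 8) (q ^ 3 / q) = EE (q ^ 2) / EE (q ^ 4) := by
    have := po1 h2
    have g := poch_even_odd (q ^ 2) h4
    rw [← pow_mul] at this g
    norm_num at this g
    rw [tht, show q ^ 3 / q = q ^ 2 by field_simp, show q ^ 8 / q ^ 2 = q ^ 2 * q ^ 4 by field_simp,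
      ← g, this]
  have e1 := EE_ne hq
  have e2 := EEn_ne hq two_ne_zero
  have e4 := EEn_ne hq four_ne_zero
  have e8 := EEn_ne hq (show 8 ≠ 0 by norm_num)
  have W : JJ (q ^ 8) q - JJ (q ^ 8) (q ^ 3) =
      q * EE (q ^ 8) ^ 2 * EE (q ^ 4) * EE (q ^ 2) ^ 3 / EE q ^ 2 := by
    rw [← mul_pow, t1, t2, t3] at D
    change _ = -q * EE (q ^ 8) ^ 4 * _ at D
    field_simp at D ⊢
    linear_combination -D
  rw [mono_W1 hq0 hq] at W
  have x4 := ph_four hq0 hq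
  have y4 := ph_neg_four hq0 hq
  have X4 := ph_four (pow_ne_zero 2 hq0) h2
  rw [← pow_mul] at X4
  norm_num at X4
  rw [x4, y4, X4, ← W]
  linear_combination -O + 6 * (JJ (q ^ 8) q - JJ (q ^ 8) (q ^ 3)) * Jsum

lemma zeta_norm {ζ : ℂ} (h : ζ ^ 4 = -1) : ‖ζ‖ = 1 := by
  have : ‖ζ‖ ^ 4 = 1 := by rw [← norm_pow, h]; simp
  exact (pow_eq_one_iff_of_nonneg (norm_nonneg _) four_ne_zero).mp this

theorem K_second {q ζ : ℂ} (hq0 : q ≠ 0) (hq : ‖q‖ < 1) (hζ : ζ ^ 4 = -1) :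
    KK q ζ - KK q (ζ ^ 3) = (ζ - ζ ^ 3) * (ph (q ^ 2) * ph q * ph (-q) ^ 2 *
      (ph q ^ 4 - 2 * ph (-q) ^ 4 + 12 * ph (q ^ 2) ^ 4)) := by
  have h2 := norm_sq_lt hq
  have h4 := norm_pow_lt hq four_ne_zero
  have hn := zeta_norm hζ
  have hζ0 : ζ ≠ 0 := fun h => by rw [h] at hζ; norm_num at hζ
  have hζ1 : ζ ≠ 1 := fun h => by rw [h] at hζ; norm_num at hζ
  have hζ3 : ζ ^ 3 ≠ 1 := fun h => hζ1 (by
    have h9 : ζ ^ 9 = ζ := by linear_combination ζ * (ζ ^ 4 - 1) * hζ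
    rw [← h9, show ζ ^ 9 = (ζ ^ 3) ^ 3 by ring, h]; norm_num)
  have c1 := unit_cond hn hζ1 hq0 hq
  have c3 := unit_cond (u := ζ ^ 3) (by rw [norm_pow, hn]; norm_num) hζ3 hq0 hq
  have hz3 := pow_ne_zero 3 hζ0
  have D := J_diff hq0 hq hz3 hζ0 c3 c1
  have O := ode hq0 hq hz3 hζ0 c3 c1
  have i1 : q / ζ = -(ζ ^ 3 * q) := by
    field_simp; linear_combination hζ
  have i3 : q / ζ ^ 3 = -(ζ * q) := by
    field_simp; linear_combination hζ
  have p1 : ∀ z : ℂ, ‖z‖ = 1 → ∀ n : ℕ, (z * q * q ^ n) ^ 2 ≠ 1 := fun z hz n h => by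
    have h5 := congrArg norm h
    have h6 := norm_pow_lt hq (show (n + 1) * 2 ≠ 0 by positivity)
    rw [mul_assoc, ← pow_succ', mul_pow, norm_mul, norm_pow z, hz, one_pow, one_mul, ← pow_mul,
      norm_one] at h5
    linarith
  have z6 : (ζ ^ 3) ^ 2 = -ζ ^ 2 := by linear_combination ζ ^ 2 * hζ
  have n2 : ((1 - ζ) * (1 - ζ ^ 3)) ^ 2 = -2 := by
    rw [show (1 - ζ) * (1 - ζ ^ 3) = -(ζ + ζ ^ 3) by linear_combination hζ]
    linear_combination (2 + ζ ^ 2) * hζ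
  have Jsum : JJ q ζ + JJ q (ζ ^ 3) = -2 + 64 * SS (q ^ 8) - 16 * SS (q ^ 4) := by
    have g1 := gs_neg (w := ζ * q) hq (p1 ζ hn)
    have g3 := gs_neg (w := ζ ^ 3 * q) hq (p1 (ζ ^ 3) (by rw [norm_pow, hn]; norm_num))
    have g2 := gs_neg (w := ζ ^ 2 * q ^ 2) (Q := q ^ 2) h2 (fun n h => by
      have h5 := congrArg norm h
      have h6 := norm_pow_lt hq (show (n + 1) * 4 ≠ 0 by positivity)
      rw [show (ζ ^ 2 * q ^ 2 * (q ^ 2) ^ n) ^ 2 = ζ ^ 4 * q ^ ((n + 1) * 4) by ring, hζ, norm_mul,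
        norm_neg, norm_one, one_mul] at h5
      linarith)
    have g4 := SS_neg_w h4
    rw [mul_pow, z6] at g3
    rw [mul_pow] at g1
    rw [show (ζ ^ 2 * q ^ 2) ^ 2 = -q ^ 4 by linear_combination q ^ 4 * hζ, ← pow_mul] at g2
    rw [← pow_mul] at g4
    norm_num at g2 g4
    have s1 : gs ζ q = ss ζ + gs (ζ * q) q := by
      unfold gs
      rw [(ss_summable ζ hq).tsum_eq_zero_add]
      congr 1
      · simp
      · refine tsum_congr fun n => ?_
        congr 1; ring
    have s3 : gs (ζ ^ 3) q = ss (ζ ^ 3) + gs (ζ ^ 3 * q) q := by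
      unfold gs
      rw [(ss_summable (ζ ^ 3) hq).tsum_eq_zero_add]
      congr 1
      · simp
      · refine tsum_congr fun n => ?_
        congr 1; ring
    have s0 : ss ζ + ss (ζ ^ 3) = -2 := by
      have a1 : 1 - ζ ≠ 0 := fun h0 => hζ1 (by linear_combination -h0)
      have a3 : 1 - ζ ^ 3 ≠ 0 := fun h0 => hζ3 (by linear_combination -h0)
      unfold ss
      field_simp
      linear_combination (ζ ^ 3 + ζ - 4) * hζ + 2 * n2
    rw [JJ_gs hq, JJ_gs hq, i1, i3, s1, s3]
    rw [neg_mul] at g3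
    linear_combination g1 + g3 + s0 + 4 * g2 + 16 * g4
  have t1 : tht q (ζ ^ 3) * tht q ζ = (1 - ζ) * (1 - ζ ^ 3) * (EE (q ^ 8) / EE (q ^ 4)) := by
    have g1 := poch_mul_neg (ζ * q) hq
    have g3 := poch_mul_neg (ζ ^ 3 * q) hq
    have g2 := poch_mul_neg (ζ ^ 2 * q ^ 2) h2
    have g4 := po3 h4
    rw [mul_pow, z6] at g3
    rw [mul_pow] at g1
    rw [show (ζ ^ 2 * q ^ 2) ^ 2 = -q ^ 4 by linear_combination q ^ 4 * hζ, ← pow_mul] at g2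
    rw [← pow_mul] at g4
    norm_num at g2 g4
    rw [neg_mul] at g3
    rw [tht, tht, i1, i3, poch_succ ζ hq, poch_succ (ζ ^ 3) hq, ← g4, ← g2, ← g1, ← g3]
    ring
  have t2 : tht q (ζ ^ 3 * ζ) = 2 * (EE (q ^ 2) / EE q) ^ 2 := by
    rw [show ζ ^ 3 * ζ = -1 by linear_combination hζ, tht, show q / (-1) = -q by ring,
      poch_neg_one hq, po3 hq]; ring
  have t3 : tht q (ζ ^ 3 / ζ) = (1 - ζ ^ 2) * (EE (q ^ 4) / EE (q ^ 2)) := by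
    have g1 := poch_mul_neg (ζ ^ 2 * q) hq
    have g4 := po3 h2
    rw [show (ζ ^ 2 * q) ^ 2 = -q ^ 2 by linear_combination q ^ 2 * hζ] at g1
    rw [← pow_mul] at g4
    norm_num at g4
    rw [show ζ ^ 3 / ζ = ζ ^ 2 by field_simp, tht, show q / ζ ^ 2 = -(ζ ^ 2 * q) by
      field_simp; linear_combination hζ, poch_succ _ hq, ← g4, ← g1]
    ring
  have e1 := EE_ne hq
  have e2 := EEn_ne hq two_ne_zero
  have e4 := EEn_ne hq four_ne_zero
  have e8 := EEn_ne hq (show 8 ≠ 0 by norm_num)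
  have W : JJ q (ζ ^ 3) - JJ q ζ = (ζ - ζ ^ 3) *
      (EE q ^ 2 * EE (q ^ 2) * EE (q ^ 4) ^ 3 / EE (q ^ 8) ^ 2) := by
    rw [← mul_pow, t1, t2, t3] at D
    rw [mul_pow, n2] at D
    change _ = -ζ * EE q ^ 4 * _ at D
    field_simp at D ⊢
    linear_combination -D
  rw [mono_W2 hq0 hq] at W
  have x4 := ph_four hq0 hq
  have y4 := ph_neg_four hq0 hq
  have X4 := ph_four (pow_ne_zero 2 hq0) h2
  rw [← pow_mul] at X4
  norm_num at X4
  rw [x4, y4, X4]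
  linear_combination -O - 6 * (JJ q (ζ ^ 3) - JJ q ζ) * Jsum + (11 + 24 * SS q + 96 * SS (q ^ 4) - 384 * SS (q ^ 8)) * W

end RF7

namespace RF7

lemma cube_hasSum {w : ℂ} (hw : ‖w‖ < 1) : HasSum (fun d : ℕ => (d : ℂ) ^ 3 * w ^ d) (ssq w) := by
  have h3 := (hasSum_choose_mul_geometric_of_norm_lt_one 3 hw).mul_left 6
  have h2 := (hasSum_choose_mul_geometric_of_norm_lt_one 2 hw).mul_left 12
  have h1 := (hasSum_choose_mul_geometric_of_norm_lt_one 1 hw).mul_left 7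
  have h0 := hasSum_choose_mul_geometric_of_norm_lt_one 0 hw
  have h := ((h3.sub h2).add h1).sub h0
  have hw1 : 1 - w ≠ 0 := fun h0 => by
    rw [show w = 1 by linear_combination -h0] at hw
    simp at hw
  have e : ssq w = 6 * (1 / (1 - w) ^ (3 + 1)) - 12 * (1 / (1 - w) ^ (2 + 1)) +
      7 * (1 / (1 - w) ^ (1 + 1)) - 1 / (1 - w) ^ (0 + 1) := by
    unfold ssq ss
    field_simp
    ring
  rw [e]
  refine h.congr_fun fun d => ?_
  have c3 : ((d + 3).choose 3 : ℂ) * 6 = (d + 1) * (d + 2) * (d + 3) := by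
    have := Nat.ascFactorial_eq_factorial_mul_choose d 3
    simp [Nat.ascFactorial, Nat.factorial] at this
    have h := congrArg (Nat.cast : ℕ → ℂ) this
    push_cast at h
    linear_combination -h
  have c2 : ((d + 2).choose 2 : ℂ) * 2 = (d + 1) * (d + 2) := by
    have := Nat.ascFactorial_eq_factorial_mul_choose d 2
    simp [Nat.ascFactorial, Nat.factorial] at this
    have h := congrArg (Nat.cast : ℕ → ℂ) this
    push_cast at h
    linear_combination -h
  simp only [Nat.choose_one_right, Nat.choose_zero_right]
  push_cast
  linear_combination -(w ^ d) * c3 + 6 * w ^ d * c2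

lemma hs_congr' {β : Type*} {f g : β → ℂ} {a b : ℂ} (h : HasSum f a) (hf : ∀ k, g k = f k)
    (ha : b = a) : HasSum g b := by
  rw [ha, funext hf]; exact h

lemma pnat_hasSum {f : ℕ → ℂ} {a : ℂ} (h0 : f 0 = 0) :
    HasSum (fun n : ℕ+ => f n) a ↔ HasSum f a := by
  refine PNat.coe_injective.hasSum_iff (f := f) fun n hn => ?_
  rcases Nat.eq_zero_or_pos n with rfl | h
  · exact h0
  · exact absurd ⟨⟨n, h⟩, rfl⟩ hn

lemma lambert {c : ℕ → ℕ → ℂ} (hc : ∀ m d, ‖c m d‖ ≤ 1) {q : ℂ} (hq : ‖q‖ < 1) {row : ℕ → ℂ}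
    (h0 : row 0 = 0)
    (hrow : ∀ m, 0 < m → HasSum (fun d : ℕ => c m d * (d : ℂ) ^ 3 * (q ^ m) ^ d) (row m)) :
    ∃ T, HasSum (fun n : ℕ => (∑ x ∈ n.divisorsAntidiagonal, c x.1 x.2 * (x.2 : ℂ) ^ 3) * q ^ n) T ∧
      HasSum row T := by
  have hs := summable_prod_mul_pow (𝕜 := ℂ) 3 hq
  have hS : Summable fun x : ℕ+ × ℕ+ =>
      c x.1 x.2 * (((x.2 : ℕ) : ℂ) ^ 3 * q ^ ((x.1 : ℕ) * (x.2 : ℕ))) := by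
    refine Summable.of_norm_bounded hs.norm fun x => ?_
    rw [norm_mul]
    exact mul_le_of_le_one_left (norm_nonneg _) (hc _ _)
  obtain ⟨T, hT⟩ := hS
  refine ⟨T, ?_, ?_⟩
  rotate_left
  · rw [← pnat_hasSum h0]
    refine hT.prod_fiberwise fun m => ?_
    have := (pnat_hasSum (by simp)).mpr (hrow m m.pos)
    refine this.congr_fun fun d => ?_
    rw [pow_mul]; ring
  · rw [← pnat_hasSum (by simp)]
    have := (sigmaAntidiagonalEquivProd.hasSum_iff).mpr hT
    refine this.sigma fun n => ?_
    have h := hasSum_fintype (fun x : (n : ℕ).divisorsAntidiagonal =>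
      c x.1.1 x.1.2 * ((x.1.2 : ℂ) ^ 3 * q ^ (x.1.1 * x.1.2)))
    refine hs_congr' h (fun x => ?_) ?_
    · rfl
    rw [Finset.univ_eq_attach, (n : ℕ).divisorsAntidiagonal.sum_attach (fun x =>
      c x.1 x.2 * ((x.2 : ℂ) ^ 3 * q ^ (x.1 * x.2))), Finset.sum_mul]
    refine Finset.sum_congr rfl fun x hx => ?_
    rw [(Nat.mem_divisorsAntidiagonal.mp hx).1]; ring

lemma chi_norm (n : ℕ) : ‖((ZMod.χ₈ (n : ZMod 8) : ℤ) : ℂ)‖ ≤ 1 := by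
  generalize (n : ZMod 8) = j
  fin_cases j <;> simp [ZMod.χ₈]

lemma F1_hasSum {q : ℂ} (hq0 : q ≠ 0) (hq : ‖q‖ < 1) :
    HasSum (fun n : ℕ => ((∑ d ∈ n.divisors, ZMod.χ₈ ((n / d : ℕ) : ZMod 8) * (d : ℤ) ^ 3 : ℤ) : ℂ) *
      q ^ n) (KK (q ^ 8) q - KK (q ^ 8) (q ^ 3)) := by
  obtain ⟨T, h1, h2⟩ := lambert (c := fun m _ => ((ZMod.χ₈ (m : ZMod 8) : ℤ) : ℂ))
    (row := fun m => ((ZMod.χ₈ (m : ZMod 8) : ℤ) : ℂ) * ssq (q ^ m)) (fun m _ => chi_norm m) hq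
    (by simp) (fun m hm => by
      have := (cube_hasSum (norm_pow_lt hq hm.ne')).mul_left ((ZMod.χ₈ (m : ZMod 8) : ℤ) : ℂ)
      simpa only [mul_assoc] using this)
  have hT : T = KK (q ^ 8) q - KK (q ^ 8) (q ^ 3) := by
    rw [← h2.tsum_eq, Nat.sumByResidueClasses h2.summable 8]
    have h8 := norm_pow_lt hq (show 8 ≠ 0 by norm_num)
    have key : ∀ j : ℕ, j < 8 → ∑' k : ℕ, ((ZMod.χ₈ ((j + 8 * k : ℕ) : ZMod 8) : ℤ) : ℂ) *
        ssq (q ^ (j + 8 * k)) = ((ZMod.χ₈ (j : ZMod 8) : ℤ) : ℂ) * ∑' k : ℕ, ssq (q ^ j * (q ^ 8) ^ k) := by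
      intro j _
      rw [← tsum_mul_left]
      refine tsum_congr fun k => ?_
      have : ((j + 8 * k : ℕ) : ZMod 8) = (j : ZMod 8) := by
        push_cast
        rw [show (8 : ZMod 8) = 0 from rfl]
        ring
      rw [this, pow_add, pow_mul]
    have e : ∑ j : ZMod 8, ∑' k : ℕ, ((ZMod.χ₈ ((j.val + 8 * k : ℕ) : ZMod 8) : ℤ) : ℂ) *
        ssq (q ^ (j.val + 8 * k)) = ∑ j : Fin 8, ((ZMod.χ₈ ((j : ℕ) : ZMod 8) : ℤ) : ℂ) *
          ∑' k : ℕ, ssq (q ^ (j : ℕ) * (q ^ 8) ^ k) :=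
      Finset.sum_congr rfl fun j _ => key _ (ZMod.val_lt j)
    rw [e, Fin.sum_univ_eight, KK_eq h8, KK_eq h8, show q ^ 8 / q = q ^ 7 by field_simp,
      show q ^ 8 / q ^ 3 = q ^ 5 by field_simp]
    have x0 : ZMod.χ₈ ((0 : ℕ) : ZMod 8) = 0 := by decide
    have x1 : ZMod.χ₈ ((1 : ℕ) : ZMod 8) = 1 := by decide
    have x2 : ZMod.χ₈ ((2 : ℕ) : ZMod 8) = 0 := by decide
    have x3 : ZMod.χ₈ ((3 : ℕ) : ZMod 8) = -1 := by decide
    have x4 : ZMod.χ₈ ((4 : ℕ) : ZMod 8) = 0 := by decide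
    have x5 : ZMod.χ₈ ((5 : ℕ) : ZMod 8) = -1 := by decide
    have x6 : ZMod.χ₈ ((6 : ℕ) : ZMod 8) = 0 := by decide
    have x7 : ZMod.χ₈ ((7 : ℕ) : ZMod 8) = 1 := by decide
    simp only [Fin.val_zero, Fin.val_one, Fin.val_two, show ((3 : Fin 8) : ℕ) = 3 from rfl,
      show ((4 : Fin 8) : ℕ) = 4 from rfl, show ((5 : Fin 8) : ℕ) = 5 from rfl,
      show ((6 : Fin 8) : ℕ) = 6 from rfl, show ((7 : Fin 8) : ℕ) = 7 from rfl,
      x0, x1, x2, x3, x4, x5, x6, x7]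
    push_cast
    rw [pow_one]
    ring
  rw [← hT]
  refine h1.congr_fun fun n => ?_
  rw [Nat.sum_divisorsAntidiagonal' (f := fun m d => ((ZMod.χ₈ (m : ZMod 8) : ℤ) : ℂ) * (d : ℂ) ^ 3)]
  push_cast
  rfl

lemma zeta_chi {ζ : ℂ} (hζ : ζ ^ 4 = -1) (d : ℕ) :
    ζ ^ d + (-ζ ^ 3) ^ d - (ζ ^ 3) ^ d - (-ζ) ^ d =
      2 * (ζ - ζ ^ 3) * ((ZMod.χ₈ (d : ZMod 8) : ℤ) : ℂ) := by
  have h8 : ζ ^ 8 = 1 := by linear_combination (ζ ^ 4 - 1) * hζ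
  have hd := Nat.mod_add_div d 8
  have hlt := Nat.mod_lt d (show 8 > 0 by norm_num)
  have hcast : (d : ZMod 8) = ((d % 8 : ℕ) : ZMod 8) := (ZMod.natCast_mod d 8).symm
  have red : ∀ z : ℂ, z ^ 8 = 1 → z ^ d = z ^ (d % 8) := fun z hz => by
    conv_lhs => rw [← hd, pow_add, pow_mul, hz, one_pow, mul_one]
  rw [hcast, red ζ h8, red (-ζ ^ 3) (by linear_combination (ζ ^ 16 + ζ ^ 8 + 1) * h8),
    red (ζ ^ 3) (by linear_combination (ζ ^ 16 + ζ ^ 8 + 1) * h8), red (-ζ) (by linear_combination h8)]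
  generalize d % 8 = j at hlt
  interval_cases j
  · rw [show ZMod.χ₈ ((0 : ℕ) : ZMod 8) = 0 by decide]; simp
  · rw [show ZMod.χ₈ ((1 : ℕ) : ZMod 8) = 1 by decide]; push_cast; ring
  · rw [show ZMod.χ₈ ((2 : ℕ) : ZMod 8) = 0 by decide]; push_cast; ring
  · rw [show ZMod.χ₈ ((3 : ℕ) : ZMod 8) = -1 by decide]; push_cast
    linear_combination (-2 * ζ) * (ζ ^ 4 - 1) * hζ
  · rw [show ZMod.χ₈ ((4 : ℕ) : ZMod 8) = 0 by decide]; push_cast; ring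
  · rw [show ZMod.χ₈ ((5 : ℕ) : ZMod 8) = -1 by decide]; push_cast
    linear_combination (2 * ζ - 2 * ζ ^ 3 * (ζ ^ 8 - ζ ^ 4 + 1)) * hζ
  · rw [show ZMod.χ₈ ((6 : ℕ) : ZMod 8) = 0 by decide]; push_cast; ring
  · rw [show ZMod.χ₈ ((7 : ℕ) : ZMod 8) = 1 by decide]; push_cast
    linear_combination (2 * ζ ^ 3 - 2 * ζ * (ζ ^ 16 - ζ ^ 12 + ζ ^ 8 - ζ ^ 4 + 1)) * hζ

lemma F2_hasSum {q : ℂ} (hq0 : q ≠ 0) (hq : ‖q‖ < 1) :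
    HasSum (fun n : ℕ => ((∑ d ∈ n.divisors, ZMod.χ₈ (d : ZMod 8) * (d : ℤ) ^ 3 : ℤ) : ℂ) *
      q ^ n) ((ph (q ^ 2) * ph q * ph (-q) ^ 2 *
      (ph q ^ 4 - 2 * ph (-q) ^ 4 + 12 * ph (q ^ 2) ^ 4) - 11) / 2) := by
  obtain ⟨ζ, hζ⟩ := IsAlgClosed.exists_pow_nat_eq (-1 : ℂ) (show 0 < 4 by norm_num)
  have hn := zeta_norm hζ
  have hr2 : (ζ - ζ ^ 3) ^ 2 = 2 := by linear_combination (ζ ^ 2 - 2) * hζ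
  have hr : ζ - ζ ^ 3 ≠ 0 := fun h => by rw [h] at hr2; norm_num at hr2
  have hζ0 : ζ ≠ 0 := fun h => by rw [h] at hζ; norm_num at hζ
  set row : ℕ → ℂ := fun m => if m = 0 then 0 else
    (ssq (ζ * q ^ m) + ssq (-ζ ^ 3 * q ^ m) - ssq (ζ ^ 3 * q ^ m) - ssq (-ζ * q ^ m)) /
      (2 * (ζ - ζ ^ 3)) with hrow
  obtain ⟨T, h1, h2⟩ := lambert (c := fun _ d => ((ZMod.χ₈ (d : ZMod 8) : ℤ) : ℂ))
    (row := row) (fun _ d => chi_norm d) hq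
    (by simp [hrow]) (fun m hm => by
      have hu : ∀ u : ℂ, ‖u‖ = 1 → ‖u * q ^ m‖ < 1 := fun u hu => by
        rw [norm_mul, hu, one_mul]; exact norm_pow_lt hq hm.ne'
      have n1 := cube_hasSum (hu ζ hn)
      have n2 := cube_hasSum (hu (-ζ ^ 3) (by rw [norm_neg, norm_pow, hn, one_pow]))
      have n3 := cube_hasSum (hu (ζ ^ 3) (by rw [norm_pow, hn, one_pow]))
      have n4 := cube_hasSum (hu (-ζ) (by rw [norm_neg, hn]))
      have := (((n1.add n2).sub n3).sub n4).div_const (2 * (ζ - ζ ^ 3))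
      rw [hrow]
      simp only [hm.ne', if_false]
      refine this.congr_fun fun d => ?_
      have hz := zeta_chi hζ d
      rw [mul_pow, mul_pow, mul_pow, mul_pow]
      rw [eq_div_iff (mul_ne_zero two_ne_zero hr)]
      linear_combination -((d : ℂ) ^ 3 * (q ^ m) ^ d) * hz)
  have K := K_second hq0 hq hζ
  have hT : T = (ph (q ^ 2) * ph q * ph (-q) ^ 2 *
      (ph q ^ 4 - 2 * ph (-q) ^ 4 + 12 * ph (q ^ 2) ^ 4) - 11) / 2 := by
    have hsh : ∀ u : ℂ, ∑' n : ℕ, ssq (u * q ^ n) = ssq u + ∑' n : ℕ, ssq (u * q * q ^ n) := fun u => by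
      rw [(ssq_summable u hq).tsum_eq_zero_add]
      congr 1
      · simp
      · refine tsum_congr fun n => ?_
        congr 1; ring
    have i1 : q / ζ = -ζ ^ 3 * q := by
      field_simp; linear_combination hζ
    have i3 : q / ζ ^ 3 = -ζ * q := by
      field_simp; linear_combination hζ
    have hS := (((ssq_summable (ζ * q) hq).hasSum.add (ssq_summable (-ζ ^ 3 * q) hq).hasSum).sub
      (ssq_summable (ζ ^ 3 * q) hq).hasSum).sub (ssq_summable (-ζ * q) hq).hasSum
    have h3 := (hasSum_nat_add_iff' 1).mpr h2
    simp only [Finset.sum_range_one, show row 0 = 0 by simp [hrow], sub_zero] at h3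
    have h4 := h3.unique ((hS.div_const (2 * (ζ - ζ ^ 3))).congr_fun fun n => by
      simp only [hrow, Nat.succ_ne_zero, if_false]
      rw [show ∀ u : ℂ, u * q ^ (n + 1) = u * q * q ^ n from fun u => by ring]
      simp only [mul_assoc, pow_succ'])
    rw [KK_eq hq, KK_eq hq, i1, i3, hsh ζ, hsh (ζ ^ 3)] at K
    have s0 : ssq ζ - ssq (ζ ^ 3) = 11 * (ζ - ζ ^ 3) := by
      have hζ1 : ζ ≠ 1 := fun h => by rw [h] at hζ; norm_num at hζ
      have hζ3 : ζ ^ 3 ≠ 1 := fun h => hζ1 (by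
        have h9 : ζ ^ 9 = ζ := by linear_combination ζ * (ζ ^ 4 - 1) * hζ
        rw [← h9, show ζ ^ 9 = (ζ ^ 3) ^ 3 by ring, h]; norm_num)
      have a1 : 1 - ζ ≠ 0 := fun h0 => hζ1 (by linear_combination -h0)
      have a3 : 1 - ζ ^ 3 ≠ 0 := fun h0 => hζ3 (by linear_combination -h0)
      have b1 : ss ζ = -((ζ - ζ ^ 3) + 2) / 2 := by
        unfold ss
        rw [div_eq_div_iff (pow_ne_zero 2 a1) two_ne_zero]
        linear_combination (2 - ζ) * hζ
      have b3 : ss (ζ ^ 3) = ((ζ - ζ ^ 3) - 2) / 2 := by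
        unfold ss
        rw [div_eq_div_iff (pow_ne_zero 2 a3) two_ne_zero]
        linear_combination -(ζ * (1 - ζ ^ 4) - 2 + ζ ^ 3) * hζ
      unfold ssq
      rw [b1, b3]; ring
    rw [h4, div_eq_div_iff (mul_ne_zero two_ne_zero hr) two_ne_zero]
    linear_combination 2 * K - 2 * s0
  rw [← hT]
  refine h1.congr_fun fun n => ?_
  rw [Nat.sum_divisorsAntidiagonal' (f := fun m d => ((ZMod.χ₈ (d : ZMod 8) : ℤ) : ℂ) * (d : ℂ) ^ 3)]
  push_cast
  rfl

end RF7

namespace RF7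

lemma pi_hasSum (k : ℕ) (f : Fin k → ℤ → ℂ) (A : Fin k → ℂ) (h : ∀ i, HasSum (f i) (A i)) :
    HasSum (fun x : Fin k → ℤ => ∏ i, f i (x i)) (∏ i, A i) := by
  induction k with
  | zero => simp
  | succ k ih =>
    have h1 := ih (fun i => f i.succ) (fun i => A i.succ) (fun i => h i.succ)
    have hs : Summable fun x : ℤ × (Fin k → ℤ) => f 0 x.1 * ∏ i, f (Fin.succ i) (x.2 i) :=
      summable_mul_of_summable_norm (f := f 0) (g := fun x : Fin k → ℤ => ∏ i, f (Fin.succ i) (x i))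
        (h 0).summable.norm h1.summable.norm
    have h2 := (h 0).mul h1 hs
    rw [← (Fin.consEquiv (fun _ : Fin (k + 1) => ℤ)).hasSum_iff, Fin.prod_univ_succ]
    refine h2.congr_fun fun x => ?_
    simp [Fin.consEquiv, Fin.prod_univ_succ]

lemma rep_hasSum (a : Fin 8 → ℕ) (ha : ∀ i, a i ≠ 0) {q : ℂ} (hq0 : q ≠ 0) (hq : ‖q‖ < 1) :
    HasSum (fun n : ℕ => (repCount a n : ℂ) * q ^ n) (∏ i, ph (q ^ a i)) := by
  have h := pi_hasSum 8 (fun i k => 1 ^ k * (q ^ a i) ^ (k ^ 2)) (fun i => ph (q ^ a i)) (fun i =>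
    Th_hasSum (pow_ne_zero _ hq0) (norm_pow_lt hq (ha i)) one_ne_zero)
  set N : (Fin 8 → ℤ) → ℕ := fun x => ∑ i, a i * (x i).natAbs ^ 2 with hN
  have h' : HasSum (fun x : Fin 8 → ℤ => q ^ N x) (∏ i, ph (q ^ a i)) := by
    refine h.congr_fun fun x => ?_
    rw [hN, ← Finset.prod_pow_eq_pow_sum]
    refine Finset.prod_congr rfl fun i _ => ?_
    rw [one_zpow, one_mul, pow_mul, ← zpow_natCast (q ^ a i)]
    congr 1
    simp
  have h2 := (Equiv.sigmaFiberEquiv N).hasSum_iff.mpr h'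
  refine h2.sigma fun n => ?_
  have hs := h2.summable.sigma_factor n
  have e : ∀ c : {x // N x = n}, ((fun x => q ^ N x) ∘ (Equiv.sigmaFiberEquiv N)) ⟨n, c⟩ = q ^ n :=
    fun c => by simp [Equiv.sigmaFiberEquiv, c.2]
  simp only [e] at hs ⊢
  have := hs.hasSum
  rw [tsum_const, nsmul_eq_mul] at this
  refine hs_congr' this (fun _ => rfl) ?_
  congr 2
  unfold repCount
  refine Nat.card_congr (Equiv.subtypeEquivRight fun x => ?_)
  rw [hN, ← Nat.cast_inj (R := ℤ)]
  push_cast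
  simp

lemma eta_eq (z : ℂ) (k : ℕ) : dedekindEta (k * z) =
    cexp (π * I * z / 12) ^ k * EE (cexp (2 * π * I * z) ^ k) := by
  unfold dedekindEta EE poch
  congr 1
  · rw [← Complex.exp_nat_mul]; congr 1; ring
  · refine tprod_congr fun n => ?_
    rw [← pow_succ', ← pow_mul, ← Complex.exp_nat_mul]
    congr 2; push_cast; ring

lemma exists_z {q : ℂ} (hq0 : q ≠ 0) (hq : ‖q‖ < 1) :
    ∃ z : ℂ, 0 < z.im ∧ cexp (2 * π * I * z) = q := by
  obtain ⟨t, ht, h⟩ := exists_exp hq0 hq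
  refine ⟨t / 2, by simpa using ht, ?_⟩
  rw [← h]; congr 1; ring

lemma exp24 (z : ℂ) : cexp (π * I * z / 12) ^ 24 = cexp (2 * π * I * z) := by
  rw [← Complex.exp_nat_mul]; congr 1; push_cast; ring

/-- drop the zeroth coefficient -/
def drop0 (a : ℕ → ℤ) (n : ℕ) : ℤ := if n = 0 then 0 else a n

lemma drop_hasSum {a : ℕ → ℤ} {q S : ℂ} (hS : S ≠ 0)
    (h : S = ∑' m : ℕ, (a (m + 1) : ℂ) * q ^ (m + 1)) :
    HasSum (fun n : ℕ => (drop0 a n : ℂ) * q ^ n) S := by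
  have hs : Summable fun m : ℕ => (a (m + 1) : ℂ) * q ^ (m + 1) := by
    by_contra hc
    rw [tsum_eq_zero_of_not_summable hc] at h
    exact hS h
  have h2 := hs.hasSum
  rw [← h] at h2
  rw [← hasSum_nat_add_iff' 1]
  simpa [drop0] using h2

lemma A1_hasSum {a1 : ℕ → ℤ} (ha1 : ∀ z : ℂ, 0 < z.im →
      dedekindEta z ^ (-2 : ℤ) * dedekindEta (2 * z) ^ (11 : ℤ) * dedekindEta (4 * z) ^ (-3 : ℤ) * dedekindEta (8 * z) ^ (2 : ℤ)
        = ∑' m : ℕ, (a1 (m + 1) : ℂ) * Complex.exp (2 * Real.pi * Complex.I * z) ^ (m + 1))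
    {q : ℂ} (hq0 : q ≠ 0) (hq : ‖q‖ < 1) :
    HasSum (fun n : ℕ => (drop0 a1 n : ℂ) * q ^ n)
      (ph (q ^ 2) * ph q * (ph q * ph (-q)) ^ 2 * (ph q ^ 2 - ph (-q) ^ 2) / 8) := by
  obtain ⟨z, hz, rfl⟩ := exists_z hq0 hq
  rw [← mono_A1 hq0 hq]
  have e1 := EE_ne hq
  have e2 := EEn_ne hq two_ne_zero
  have e4 := EEn_ne hq four_ne_zero
  have e8 := EEn_ne hq (show 8 ≠ 0 by norm_num)
  refine drop_hasSum (by positivity) ?_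
  rw [← ha1 z hz]
  have t1 := eta_eq z 1
  have t2 := eta_eq z 2
  have t4 := eta_eq z 4
  have t8 := eta_eq z 8
  push_cast at t1 t2 t4 t8
  rw [one_mul, pow_one, pow_one] at t1
  rw [t1, t2, t4, t8]
  have h24 := exp24 z
  have hw : cexp (π * I * z / 12) ≠ 0 := Complex.exp_ne_zero _
  generalize cexp (π * I * z / 12) = w at *
  generalize cexp (2 * π * I * z) = q at *
  rw [zpow_neg, zpow_neg]
  norm_cast
  field_simp
  linear_combination -h24

lemma A2_hasSum {a2 : ℕ → ℤ} (ha2 : ∀ z : ℂ, 0 < z.im →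
      dedekindEta z ^ (2 : ℤ) * dedekindEta (2 * z) ^ (-3 : ℤ) * dedekindEta (4 * z) ^ (11 : ℤ) * dedekindEta (8 * z) ^ (-2 : ℤ)
        = ∑' m : ℕ, (a2 (m + 1) : ℂ) * Complex.exp (2 * Real.pi * Complex.I * z) ^ (m + 1))
    {q : ℂ} (hq0 : q ≠ 0) (hq : ‖q‖ < 1) :
    HasSum (fun n : ℕ => (drop0 a2 n : ℂ) * q ^ n)
      (ph (q ^ 2) * ph (-q) * (ph q * ph (-q)) * ph (q ^ 2) ^ 2 * (ph q ^ 2 - ph (-q) ^ 2) / 8) := by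
  obtain ⟨z, hz, rfl⟩ := exists_z hq0 hq
  rw [← mono_A2 hq0 hq]
  have e1 := EE_ne hq
  have e2 := EEn_ne hq two_ne_zero
  have e4 := EEn_ne hq four_ne_zero
  have e8 := EEn_ne hq (show 8 ≠ 0 by norm_num)
  refine drop_hasSum (by positivity) ?_
  rw [← ha2 z hz]
  have t1 := eta_eq z 1
  have t2 := eta_eq z 2
  have t4 := eta_eq z 4
  have t8 := eta_eq z 8
  push_cast at t1 t2 t4 t8
  rw [one_mul, pow_one, pow_one] at t1
  rw [t1, t2, t4, t8]
  have h24 := exp24 z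
  have hw : cexp (π * I * z / 12) ≠ 0 := Complex.exp_ne_zero _
  generalize cexp (π * I * z / 12) = w at *
  generalize cexp (2 * π * I * z) = q at *
  rw [zpow_neg, zpow_neg]
  norm_cast
  field_simp
  linear_combination -h24

lemma half_hasSum {f : ℕ → ℤ} {q S : ℂ} (h : HasSum (fun n : ℕ => (f n : ℂ) * (q ^ 2) ^ n) S) :
    HasSum (fun n : ℕ => ((half f n : ℚ) : ℂ) * q ^ n) S := by
  have inj : Function.Injective (fun k : ℕ => 2 * k) := fun a b hab => by
    simp only at hab; omega
  refine (inj.hasSum_iff (fun n hn => ?_)).mp (h.congr_fun fun n => ?_)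
  · have : ¬ 2 ∣ n := fun ⟨k, hk⟩ => hn ⟨k, hk.symm⟩
    simp [half, this]
  · simp [half, pow_mul]

lemma coeff_unique {c : ℕ → ℂ}
    (h : ∀ q : ℂ, q ≠ 0 → ‖q‖ < 1 → HasSum (fun n : ℕ => c n * q ^ n) 0) : ∀ n, c n = 0 := by
  set f : ℂ → ℂ := fun z => if z = 0 then c 0 else 0 with hf
  have hp : HasFPowerSeriesAt f (FormalMultilinearSeries.ofScalars ℂ c) 0 := by
    rw [hasFPowerSeriesAt_iff]
    filter_upwards [Metric.ball_mem_nhds (0 : ℂ) one_pos] with z hz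
    rw [mem_ball_zero_iff] at hz
    by_cases h0 : z = 0
    · subst h0
      have := hasSum_single (f := fun n : ℕ => (0 : ℂ) ^ n • c n) 0 (fun n hn => by simp [hn])
      simpa [hf] using this
    · have := h z h0 hz
      simp only [hf, zero_add, h0, if_false]
      refine this.congr_fun fun n => ?_
      simp [mul_comm]
  have hcont := hp.continuousAt
  have h0 : c 0 = 0 := by
    have t1 : Filter.Tendsto f (nhdsWithin 0 {0}ᶜ) (nhds (c 0)) := by
      have := hcont.tendsto.mono_left (nhdsWithin_le_nhds (s := {(0 : ℂ)}ᶜ))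
      simpa [hf] using this
    have t2 : Filter.Tendsto f (nhdsWithin 0 {0}ᶜ) (nhds 0) := by
      refine tendsto_const_nhds.congr' ?_
      filter_upwards [self_mem_nhdsWithin] with z hz
      have : z ≠ 0 := hz
      simp [hf, this]
    exact tendsto_nhds_unique t1 t2
  have hf0 : f = 0 := by
    funext z
    simp [hf, h0]
  rw [hf0] at hp
  have := hp.eq_zero
  intro n
  have h1 := congrArg (fun p => FormalMultilinearSeries.coeff p n) this
  have h2 : FormalMultilinearSeries.coeff (0 : FormalMultilinearSeries ℂ ℂ ℂ) n = 0 := rfl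
  simpa [h2] using h1

end RF7

namespace RF7

lemma poly_id (x y X Y p : ℂ) (h1 : x ^ 2 + y ^ 2 = 2 * X ^ 2) (h2 : x * y = Y ^ 2)
    (h3 : x + y = 2 * p) :
    11 * (x ^ 3 * X ^ 3 * p ^ 2) =
      16 * (X * x * (x ^ 2 - y ^ 2) / 8 * (x ^ 4 / 2 - y ^ 4 / 4 + 3 / 4 * X ^ 4)) +
      (p * X * Y ^ 2 * (X ^ 4 - 2 * Y ^ 4 + 12 * p ^ 4)) +
      4 * (X * x * (x * y) ^ 2 * (x ^ 2 - y ^ 2) / 8) +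
      46 * (X * y * (x * y) * X ^ 2 * (x ^ 2 - y ^ 2) / 8) +
      136 * (p * X * (X * Y) ^ 2 * (X ^ 2 - Y ^ 2) / 8) +
      16 * (p * Y * (X * Y) * p ^ 2 * (X ^ 2 - Y ^ 2) / 8) := by
  have e1 : X ^ 2 = (x ^ 2 + y ^ 2) / 2 := by linear_combination -h1 / 2
  have e3 : p = (x + y) / 2 := by linear_combination -h3 / 2
  rw [show X ^ 3 = X * X ^ 2 by ring, show X ^ 4 = (X ^ 2) ^ 2 by ring,
    show Y ^ 4 = (Y ^ 2) ^ 2 by ring, show (X * Y) ^ 2 = X ^ 2 * Y ^ 2 by ring,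
    show p * Y * (X * Y) = p * X * Y ^ 2 by ring, ← h2, e1, e3]
  ring

lemma half_drop {a : ℕ → ℤ} {n : ℕ} (hn : 0 < n) : half (drop0 a) n = half a n := by
  unfold half
  split_ifs with h
  · have : n / 2 ≠ 0 := by omega
    simp [drop0, this]
  · rfl

end RF7

theorem representation_formula_7
    (a1 a2 : ℕ → ℤ)
    (ha1 : ∀ z : ℂ, 0 < z.im →
      dedekindEta z ^ (-2 : ℤ) * dedekindEta (2 * z) ^ (11 : ℤ) * dedekindEta (4 * z) ^ (-3 : ℤ) * dedekindEta (8 * z) ^ (2 : ℤ)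
        = ∑' m : ℕ, (a1 (m + 1) : ℂ) * Complex.exp (2 * Real.pi * Complex.I * z) ^ (m + 1))
    (ha2 : ∀ z : ℂ, 0 < z.im →
      dedekindEta z ^ (2 : ℤ) * dedekindEta (2 * z) ^ (-3 : ℤ) * dedekindEta (4 * z) ^ (11 : ℤ) * dedekindEta (8 * z) ^ (-2 : ℤ)
        = ∑' m : ℕ, (a2 (m + 1) : ℂ) * Complex.exp (2 * Real.pi * Complex.I * z) ^ (m + 1))
    (n : ℕ) (hn : 0 < n) :
    (repCount ![1, 1, 1, 2, 2, 2, 4, 4] n : ℚ) =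
    (((16 : ℚ) / 11) * (sigmaChi8One n : ℚ) + ((2 : ℚ) / 11) * half sigmaOneChi8 n
      + ((4 : ℚ) / 11) * (a1 n : ℚ) + ((46 : ℚ) / 11) * (a2 n : ℚ)
      + ((136 : ℚ) / 11) * half a1 n + ((16 : ℚ) / 11) * half a2 n) := by 
  have main : ∀ q : ℂ, q ≠ 0 → ‖q‖ < 1 → HasSum (fun m : ℕ =>
      (11 * (repCount ![1, 1, 1, 2, 2, 2, 4, 4] m : ℂ) - (16 * (sigmaChi8One m : ℂ)
        + 2 * ((half sigmaOneChi8 m : ℚ) : ℂ) + 4 * (RF7.drop0 a1 m : ℂ) + 46 * (RF7.drop0 a2 m : ℂ)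
        + 136 * ((half (RF7.drop0 a1) m : ℚ) : ℂ) + 16 * ((half (RF7.drop0 a2) m : ℚ) : ℂ)
        + (if m = 0 then 11 else 0))) * q ^ m) 0 := by
    intro q hq0 hq
    have hQ0 : q ^ 2 ≠ 0 := pow_ne_zero 2 hq0
    have hQ := RF7.norm_sq_lt hq
    have R := (RF7.rep_hasSum ![1, 1, 1, 2, 2, 2, 4, 4] (by decide) hq0 hq).mul_left 11
    have F1 := (RF7.F1_hasSum hq0 hq).mul_left 16
    have F2 := (RF7.half_hasSum (f := sigmaOneChi8) (RF7.F2_hasSum hQ0 hQ)).mul_left 2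
    have A1 := (RF7.A1_hasSum ha1 hq0 hq).mul_left 4
    have A2 := (RF7.A2_hasSum ha2 hq0 hq).mul_left 46
    have B1 := (RF7.half_hasSum (RF7.A1_hasSum ha1 hQ0 hQ)).mul_left 136
    have B2 := (RF7.half_hasSum (RF7.A2_hasSum ha2 hQ0 hQ)).mul_left 16
    have C : HasSum (fun m : ℕ => (if m = 0 then (11 : ℂ) else 0) * q ^ m) 11 := by
      have := hasSum_single (f := fun m : ℕ => (if m = 0 then (11 : ℂ) else 0) * q ^ m) 0
        (fun m hm => by simp [hm])
      simpa using this
    rw [RF7.K_first hq0 hq] at F1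
    have tot := R.sub ((((((F1.add F2).add A1).add A2).add B1).add B2).add C)
    refine RF7.hs_congr' tot (fun m => ?_) ?_
    · simp only [sigmaChi8One]
      ring
    · rw [Fin.prod_univ_eight]
      have h1 := RF7.rel_add hq0 hq
      have h2 := RF7.rel_mul hq0 hq
      have h3 := RF7.rel_half hq0 hq
      have id := RF7.poly_id _ _ _ _ _ h1 h2 h3
      have e4 : (q ^ 2) ^ 2 = q ^ 4 := by ring
      rw [e4]
      simp only [Matrix.cons_val, pow_one]
      linear_combination -id
  have key := RF7.coeff_unique main n
  rw [RF7.half_drop hn, RF7.half_drop hn] at key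
  have hn' := hn.ne'
  simp only [RF7.drop0, hn', if_false, add_zero] at key
  have key2 : 11 * (repCount ![1, 1, 1, 2, 2, 2, 4, 4] n : ℚ) - (16 * (sigmaChi8One n : ℚ)
        + 2 * half sigmaOneChi8 n + 4 * (a1 n : ℚ) + 46 * (a2 n : ℚ)
        + 136 * half a1 n + 16 * half a2 n) = 0 := by
    exact_mod_cast key
  linear_combination key2 / 11
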